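/- Let μ ∈ 𝓜 with distribution function α, let 0 < s < t ≤ 1 with α(s) > 0 and ∫_s^t α(r)ζ(r) dr < 1, and let x ∈ ℝ. Then the maximizer of F^{s,t}(·,x) over 𝓓[s,t] is unique: if u ∈ 𝓓[s,t] satisfies F^{s,t}(u,x) = Φ_μ(s,x), then ‖u − u*‖ = 0, where u*(r) = ∂_x Φ_μ(r, X(r)) and X is the continuous adapted process satisfying X(r) = x + ∫_s^r α(v)ζ(v) ∂_x Φ_μ(v, X(v)) dv + W(r) − W(s) for r ∈ [s,t]. -/

import Mathlib

open MeasureTheory ProbabilityTheory Real Set Filter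

noncomputable section

/-- `ξ(s) = ∑_{p≥2} β_p² s^p` (we use `β : ℕ → ℝ` with `β 0 = β 1 = 0`). -/
def xiFn (β : ℕ → ℝ) (s : ℝ) : ℝ := ∑' p : ℕ, β p ^ 2 * s ^ p

/-- `ξ'(s)`. -/
def xiD (β : ℕ → ℝ) (s : ℝ) : ℝ := ∑' p : ℕ, (p : ℝ) * β p ^ 2 * s ^ (p - 1)

/-- `ζ(s) = ξ''(s)`. -/
def zetaFn (β : ℕ → ℝ) (s : ℝ) : ℝ :=
  ∑' p : ℕ, (p : ℝ) * ((p : ℝ) - 1) * β p ^ 2 * s ^ (p - 2)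

/-- admissible sequence of temperature parameters -/
def ValidBeta (β : ℕ → ℝ) : Prop :=
  β 0 = 0 ∧ β 1 = 0 ∧ (∀ p, 0 ≤ β p) ∧ (∃ p, 2 ≤ p ∧ 0 < β p) ∧
    Summable fun p : ℕ => (2 : ℝ) ^ p * β p ^ 2

/-- membership in `𝓜`: a Borel probability measure concentrated on `[0,1]` -/
def MemM (μ : Measure ℝ) : Prop := IsProbabilityMeasure μ ∧ μ (Icc (0 : ℝ) 1)ᶜ = 0

/-- member of `𝓜_d`: finitely supported -/
def FinSupp (μ : Measure ℝ) : Prop := ∃ S : Finset ℝ, μ ((S : Set ℝ))ᶜ = 0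

/-- the distribution function `α(s) = μ([0,s])` -/
def distF (μ : Measure ℝ) (s : ℝ) : ℝ := (μ (Icc 0 s)).toReal

/-- the metric `d(μ,ν) = ∫_0^1 |μ([0,s]) - ν([0,s])| ds` -/
def dM (μ ν : Measure ℝ) : ℝ := ∫ s in (0 : ℝ)..1, |distF μ s - distF ν s|

/-- the smallest atom of `μ` strictly after `s` (or `1` if there is none) -/
def nextPt (μ : Measure ℝ) (s : ℝ) : ℝ :=
  sInf ({q : ℝ | s < q ∧ q ≤ 1 ∧ μ {q} ≠ 0} ∪ {1})

/-- one step of the backward recursion defining the Parisi PDE solution: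
`(1/m) log E exp (m Φ(t, x + z √(ξ'(t) - ξ'(s))))`, interpreted as
`E Φ(t, x + z √(ξ'(t) - ξ'(s)))` when `m = 0`. -/
def gStep (β : ℕ → ℝ) (Φ : ℝ → ℝ → ℝ) (m t s x : ℝ) : ℝ :=
  if m = 0 then ∫ z, Φ t (x + z * Real.sqrt (xiD β t - xiD β s)) ∂(gaussianReal 0 1)
  else m⁻¹ * Real.log
    (∫ z, Real.exp (m * Φ t (x + z * Real.sqrt (xiD β t - xiD β s))) ∂(gaussianReal 0 1))

/-- `Φ` is the Parisi PDE solution of a finitely supported `μ`. -/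
def IsAtomicSol (β : ℕ → ℝ) (μ : Measure ℝ) (Φ : ℝ → ℝ → ℝ) : Prop :=
  (∀ x : ℝ, Φ 1 x = Real.log (Real.cosh x)) ∧
  (∀ s ∈ Ico (0 : ℝ) 1, ∀ x : ℝ, Φ s x = gStep β Φ (distF μ s) (nextPt μ s) s x)

/-- `Φ` is the Parisi family `μ ↦ Φ_μ`: it satisfies the backward recursion on `𝓜_d`
and is `d`-continuous on `𝓜` (uniformly in `(s,x) ∈ [0,1] × ℝ`). -/
def IsParisiFamily (β : ℕ → ℝ) (Φ : Measure ℝ → ℝ → ℝ → ℝ) : Prop :=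
  (∀ μ, MemM μ → FinSupp μ → IsAtomicSol β μ (Φ μ)) ∧
  (∀ μ, MemM μ → ∀ ε : ℝ, 0 < ε → ∃ δ : ℝ, 0 < δ ∧ ∀ ν, MemM ν → dM μ ν < δ →
      ∀ s ∈ Icc (0 : ℝ) 1, ∀ x : ℝ, |Φ μ s x - Φ ν s x| < ε)

/-- `B` is a standard Brownian motion under `P`. -/
def IsStdBM {Ω : Type*} [MeasurableSpace Ω] (P : Measure Ω) (B : ℝ → Ω → ℝ) : Prop :=
  (∀ t : ℝ, Measurable (B t)) ∧
  (∀ᵐ ω ∂P, B 0 ω = 0) ∧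
  (∀ᵐ ω ∂P, Continuous fun t => B t ω) ∧
  (∀ s t : ℝ, 0 ≤ s → s ≤ t →
    Measure.map (fun ω => B t ω - B s ω) P = gaussianReal 0 (Real.toNNReal (t - s))) ∧
  (∀ s t : ℝ, 0 ≤ s → s ≤ t →
    Indep (MeasurableSpace.comap (fun ω => B t ω - B s ω) inferInstance)
      (⨆ v ∈ Icc (0 : ℝ) s, MeasurableSpace.comap (B v) inferInstance) P)

/-- the space `𝓓[s,t]`: progressively measurable processes bounded by `1` on `[s,t]` -/
def InD {Ω : Type*} {mΩ : MeasurableSpace Ω} (𝓕 : Filtration ℝ mΩ) (s t : ℝ)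
    (u : ℝ → Ω → ℝ) : Prop :=
  ProgMeasurable 𝓕 u ∧ ∀ r ∈ Icc s t, ∀ ω, |u r ω| ≤ 1

/-- the norm `‖u‖ = (E ∫_s^t u(r)² dr)^{1/2}` on `𝓓[s,t]` -/
def normD {Ω : Type*} [MeasurableSpace Ω] (P : Measure Ω) (s t : ℝ)
    (u : ℝ → Ω → ℝ) : ℝ :=
  Real.sqrt (∫ ω, (∫ r in s..t, (u r ω) ^ 2) ∂P)

/-- the functional
`F^{s,t}(u,x) = E[Φ_μ(t, x + ∫_s^t α ζ u dr + W(t) - W(s)) - (1/2)∫_s^t α ζ u² dr]`,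
where `W r = B (ξ' r)`. -/
def Ffn {Ω : Type*} [MeasurableSpace Ω] (P : Measure Ω) (β : ℕ → ℝ) (μ : Measure ℝ)
    (Φ : ℝ → ℝ → ℝ) (W : ℝ → Ω → ℝ) (s t : ℝ) (u : ℝ → Ω → ℝ) (x : ℝ) : ℝ :=
  ∫ ω, (Φ t (x + (∫ r in s..t, distF μ r * zetaFn β r * u r ω) + (W t ω - W s ω))
      - (1 / 2) * ∫ r in s..t, distF μ r * zetaFn β r * (u r ω) ^ 2) ∂P


lemma zeta_coef_nonneg (β : ℕ → ℝ) (p : ℕ) : 0 ≤ (p : ℝ) * ((p : ℝ) - 1) * β p ^ 2 := by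
  rcases p with _ | p
  · simp
  · push_cast
    rw [add_sub_cancel_right]
    positivity

lemma zeta_coef_summable {β : ℕ → ℝ} (hβ : ValidBeta β) :
    Summable fun p : ℕ => (p : ℝ) * ((p : ℝ) - 1) * β p ^ 2 := by
  have h := hβ.2.2.2.2.mul_left 2
  refine Summable.of_nonneg_of_le (fun p => ?_) (fun p => ?_) h
  · rcases p with _ | p
    · simp
    · exact zeta_coef_nonneg β _
  · have h1 : (p.choose 2 : ℝ) ≤ 2 ^ p := by exact_mod_cast Nat.choose_le_two_pow p 2
    rw [Nat.cast_choose_two] at h1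
    nlinarith [sq_nonneg (β p)]

lemma zeta_term_le (β : ℕ → ℝ) (p : ℕ) {r : ℝ} (hr : r ∈ Icc (0:ℝ) 1) :
    ‖(p : ℝ) * ((p : ℝ) - 1) * β p ^ 2 * r ^ (p - 2)‖ ≤ (p : ℝ) * ((p : ℝ) - 1) * β p ^ 2 := by
  have h0 := zeta_coef_nonneg β p
  have h1 : r ^ (p-2) ≤ 1 := pow_le_one₀ hr.1 hr.2
  have h2 : 0 ≤ r ^ (p-2) := pow_nonneg hr.1 _
  rw [Real.norm_of_nonneg (by positivity)]
  exact mul_le_of_le_one_right h0 h1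

lemma zeta_term_summable {β : ℕ → ℝ} (hβ : ValidBeta β) {r : ℝ} (hr : r ∈ Icc (0:ℝ) 1) :
    Summable fun p : ℕ => (p : ℝ) * ((p : ℝ) - 1) * β p ^ 2 * r ^ (p - 2) :=
  Summable.of_norm_bounded (zeta_coef_summable hβ) (fun p => zeta_term_le β p hr)

lemma zeta_continuousOn {β : ℕ → ℝ} (hβ : ValidBeta β) : ContinuousOn (zetaFn β) (Icc 0 1) := by
  unfold zetaFn
  refine continuousOn_tsum (u := fun p : ℕ => (p : ℝ) * ((p : ℝ) - 1) * β p ^ 2) (fun p => ?_)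
    (zeta_coef_summable hβ) (fun p r hr => zeta_term_le β p hr)
  fun_prop

lemma zeta_nonneg (β : ℕ → ℝ) {r : ℝ} (hr : r ∈ Icc (0:ℝ) 1) : 0 ≤ zetaFn β r :=
  tsum_nonneg fun p => mul_nonneg (zeta_coef_nonneg β p) (pow_nonneg hr.1 _)

lemma zeta_mono {β : ℕ → ℝ} (hβ : ValidBeta β) {r q : ℝ} (hr : r ∈ Icc (0:ℝ) 1)
    (hq : q ∈ Icc (0:ℝ) 1) (h : r ≤ q) : zetaFn β r ≤ zetaFn β q :=
  (zeta_term_summable hβ hr).tsum_le_tsum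
    (fun p => mul_le_mul_of_nonneg_left (pow_le_pow_left₀ hr.1 h _) (zeta_coef_nonneg β p))
    (zeta_term_summable hβ hq)

lemma zeta_pos {β : ℕ → ℝ} (hβ : ValidBeta β) {r : ℝ} (hr : r ∈ Icc (0:ℝ) 1) (h : 0 < r) :
    0 < zetaFn β r := by
  obtain ⟨p, hp, hpos⟩ := hβ.2.2.2.1
  refine (zeta_term_summable hβ hr).tsum_pos
    (fun p => mul_nonneg (zeta_coef_nonneg β p) (pow_nonneg hr.1 _)) p ?_
  have : (2:ℝ) ≤ p := by exact_mod_cast hp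
  have : (0:ℝ) < p - 1 := by linarith
  positivity

lemma xiD_summable {β : ℕ → ℝ} (hβ : ValidBeta β) {r : ℝ} (hr : r ∈ Icc (0:ℝ) 1) :
    Summable fun p : ℕ => (p : ℝ) * β p ^ 2 * r ^ (p - 1) := by
  refine Summable.of_norm_bounded (zeta_coef_summable hβ) (fun p => ?_)
  have h1 : r ^ (p-1) ≤ 1 := pow_le_one₀ hr.1 hr.2
  have h2 : 0 ≤ r ^ (p-1) := pow_nonneg hr.1 _
  rw [Real.norm_of_nonneg (by positivity)]
  rcases p with _ | _ | p
  · simp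
  · simp [hβ.2.1]
  · push_cast at *
    refine (mul_le_of_le_one_right (by positivity) h1).trans ?_
    nlinarith [mul_nonneg (mul_nonneg (by positivity : (0:ℝ) ≤ p) (by positivity : (0:ℝ) ≤ p + 1 + 1)) (sq_nonneg (β (p+1+1)))]

lemma integral_zeta {β : ℕ → ℝ} (hβ : ValidBeta β) {a b : ℝ} (ha : a ∈ Icc (0:ℝ) 1)
    (hb : b ∈ Icc (0:ℝ) 1) : ∫ r in a..b, zetaFn β r = xiD β b - xiD β a := by
  have hsub : Set.uIoc a b ⊆ Icc 0 1 := Set.uIoc_subset_uIcc.trans (uIcc_subset_Icc ha hb)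
  have h := intervalIntegral.hasSum_integral_of_dominated_convergence (μ := volume) (a := a) (b := b)
    (F := fun (p : ℕ) (r : ℝ) => (p : ℝ) * ((p : ℝ) - 1) * β p ^ 2 * r ^ (p - 2))
    (f := zetaFn β) (fun p _ => (p : ℝ) * ((p : ℝ) - 1) * β p ^ 2)
    (fun p => (by fun_prop : Continuous fun r : ℝ => (p : ℝ) * ((p : ℝ) - 1) * β p ^ 2 * r ^ (p - 2)).aestronglyMeasurable)
    (fun p => .of_forall fun r hr => zeta_term_le β p (hsub hr))
    (.of_forall fun r hr => zeta_coef_summable hβ)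
    intervalIntegrable_const
    (.of_forall fun r hr => (zeta_term_summable hβ (hsub hr)).hasSum)
  rw [← h.tsum_eq]
  unfold xiD
  rw [← (xiD_summable hβ hb).tsum_sub (xiD_summable hβ ha)]
  congr 1
  ext p
  rcases p with _ | _ | p
  · simp
  · simp
  · rw [intervalIntegral.integral_const_mul]
    simp only [Nat.add_sub_cancel, show p + 1 + 1 - 1 = p + 1 by omega, show p + 1 + 1 - 2 = p by omega, integral_pow]
    push_cast
    field_simp
    ring

lemma xiD_zero {β : ℕ → ℝ} (hβ : ValidBeta β) : xiD β 0 = 0 := by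
  unfold xiD
  convert tsum_zero with p
  rcases p with _ | _ | p <;> simp [hβ.2.1]

lemma xiD_mono {β : ℕ → ℝ} (hβ : ValidBeta β) {a b : ℝ} (ha : a ∈ Icc (0:ℝ) 1)
    (hb : b ∈ Icc (0:ℝ) 1) (h : a ≤ b) : xiD β a ≤ xiD β b := by
  have := integral_zeta hβ ha hb
  have h2 : 0 ≤ ∫ r in a..b, zetaFn β r := intervalIntegral.integral_nonneg h
    fun r hr => zeta_nonneg β ⟨ha.1.trans hr.1, hr.2.trans hb.2⟩
  linarith

lemma xiD_nonneg {β : ℕ → ℝ} (hβ : ValidBeta β) {a : ℝ} (ha : a ∈ Icc (0:ℝ) 1) :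
    0 ≤ xiD β a := by
  have := xiD_mono hβ (left_mem_Icc.2 zero_le_one) ha ha.1
  rwa [xiD_zero hβ] at this

lemma xiD_continuousOn {β : ℕ → ℝ} (hβ : ValidBeta β) : ContinuousOn (xiD β) (Icc 0 1) := by
  have h : ContinuousOn (fun b => ∫ r in (0:ℝ)..b, zetaFn β r) (Icc 0 1) := by
    have := intervalIntegral.continuousOn_primitive_interval (μ := volume) (f := zetaFn β) (a := 0) (b := 1)
      (by rw [uIcc_of_le zero_le_one]; exact (zeta_continuousOn hβ).integrableOn_Icc)
    rwa [uIcc_of_le zero_le_one] at this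
  refine h.congr fun b hb => ?_
  beta_reduce
  rw [integral_zeta hβ (left_mem_Icc.2 zero_le_one) hb, xiD_zero hβ, sub_zero]

/-! ### Gaussian measures -/

/-- centered Gaussian with variance `τ` -/
def nG (τ : ℝ) : Measure ℝ := gaussianReal 0 τ.toNNReal

instance (τ : ℝ) : IsProbabilityMeasure (nG τ) := by unfold nG; infer_instance

lemma nG_exp_abs (τ c : ℝ) : Integrable (fun y => Real.exp (c * |y|)) (nG τ) := by
  unfold nG
  exact integrable_exp_mul_abs (integrable_exp_mul_gaussianReal c)
    (integrable_exp_mul_gaussianReal (-c))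

lemma nG_int_abs (τ : ℝ) : Integrable (fun y => |y|) (nG τ) := by
  refine (nG_exp_abs τ 1).mono' (by fun_prop) (.of_forall fun y => ?_)
  simp only [norm_eq_abs, abs_abs, one_mul]
  linarith [Real.add_one_le_exp |y|]

lemma nG_int_id (τ : ℝ) : Integrable (fun y => y) (nG τ) := by
  refine (nG_int_abs τ).mono' (by fun_prop) (.of_forall fun y => ?_)
  simp

lemma nG_mean (τ : ℝ) : ∫ y, y ∂(nG τ) = 0 := by unfold nG; simp

/-- functions with linear growth are integrable -/
lemma nG_int_lin {τ : ℝ} {f : ℝ → ℝ} (hf : Measurable f) {C : ℝ} (h : ∀ y, |f y| ≤ C + |y|) :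
    Integrable f (nG τ) :=
  ((integrable_const C).add (nG_int_abs τ)).mono' hf.aestronglyMeasurable
    (.of_forall fun y => by simpa using h y)

/-- functions with exponential growth are integrable -/
lemma nG_int_exp {τ : ℝ} {f : ℝ → ℝ} (hf : Measurable f) {C c : ℝ}
    (h : ∀ y, |f y| ≤ C * Real.exp (c * |y|)) : Integrable f (nG τ) :=
  ((nG_exp_abs τ c).const_mul C).mono' hf.aestronglyMeasurable
    (.of_forall fun y => by simpa using h y)

lemma nG_conv {τ₁ τ₂ : ℝ} (h₁ : 0 ≤ τ₁) (h₂ : 0 ≤ τ₂) {f : ℝ → ℝ}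
    (hf : Integrable f (nG (τ₁ + τ₂))) :
    ∫ y, f y ∂(nG (τ₁ + τ₂)) = ∫ y₁, ∫ y₂, f (y₁ + y₂) ∂(nG τ₂) ∂(nG τ₁) := by
  have : nG (τ₁ + τ₂) = (nG τ₁).conv (nG τ₂) := by
    unfold nG
    rw [gaussianReal_conv_gaussianReal, Real.toNNReal_add h₁ h₂]; simp
  rw [this] at hf ⊢
  rw [integral_conv hf]

lemma nG_scale {τ : ℝ} (h : 0 ≤ τ) {f : ℝ → ℝ} (hf : Measurable f) :
    ∫ y, f y ∂(nG τ) = ∫ z, f (z * Real.sqrt τ) ∂(gaussianReal 0 1) := by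
  have : nG τ = (gaussianReal 0 1).map (fun z => z * Real.sqrt τ) := by
    rw [gaussianReal_map_mul_const]
    unfold nG
    congr 1
    · simp
    · ext; simp [Real.sq_sqrt h, h]
  rw [this, integral_map (by fun_prop) hf.aestronglyMeasurable]

/-- Cameron-Martin shift -/
lemma nG_shift {τ : ℝ} (h : 0 ≤ τ) (c : ℝ) (f : ℝ → ℝ) :
    ∫ y, f y ∂(nG τ) = ∫ y, f (y + c * τ) * Real.exp (-(c * y) - c^2 * τ / 2) ∂(nG τ) := by
  rcases h.eq_or_lt with rfl | h
  · simp [nG]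
  have hv : τ.toNNReal ≠ 0 := by simp [h]
  unfold nG
  rw [integral_gaussianReal_eq_integral_smul hv, integral_gaussianReal_eq_integral_smul hv]
  rw [← integral_add_right_eq_self _ (c * τ)]
  congr 1; ext y
  simp only [gaussianPDFReal, smul_eq_mul, Real.coe_toNNReal _ h.le]
  have : Real.exp (-(y + c * τ - 0) ^ 2 / (2 * τ)) =
      Real.exp (-(y - 0) ^ 2 / (2 * τ)) * Real.exp (-(c * y) - c^2 * τ / 2) := by
    rw [← Real.exp_add]
    congr 1
    field_simp
    ring
  rw [this]
  ring


/-! ### The one-step operator -/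

/-- one step of the Parisi recursion over a Gaussian of variance `τ` -/
def gOp (m τ : ℝ) (g : ℝ → ℝ) (x : ℝ) : ℝ :=
  if m = 0 then ∫ y, g (x + y) ∂(nG τ)
  else m⁻¹ * Real.log (∫ y, Real.exp (m * g (x + y)) ∂(nG τ))

/-- regularity class -/
def Reg (g : ℝ → ℝ) : Prop := ∃ g1 g2 : ℝ → ℝ, (∀ x, HasDerivAt g (g1 x) x) ∧
  (∀ x, HasDerivAt g1 (g2 x) x) ∧ (∀ x, 0 ≤ g2 x) ∧ ∀ x, g2 x ≤ 1 - g1 x ^ 2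

/-- `C^{1,1}` class -/
def C1Q (f f1 : ℝ → ℝ) : Prop := (∀ x h, |f (x + h) - f x - f1 x * h| ≤ h ^ 2) ∧
  (∀ x, |f1 x| ≤ 1) ∧ (∀ x y, |f1 x - f1 y| ≤ |x - y|)

lemma lip_of_deriv {f f1 : ℝ → ℝ} (hf : ∀ x, HasDerivAt f (f1 x) x) (h1 : ∀ x, |f1 x| ≤ 1)
    (x y : ℝ) : |f x - f y| ≤ |x - y| := by
  have := convex_univ.norm_image_sub_le_of_norm_hasDerivWithin_le (s := univ) (f := f) (f' := f1)
    (C := 1) (x := y) (y := x) (fun z _ => (hf z).hasDerivWithinAt) (fun z _ => h1 z) trivial trivial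
  simpa using this

lemma Reg.c1q {g : ℝ → ℝ} (hg : Reg g) : ∃ g1, C1Q g g1 := by
  obtain ⟨g1, g2, h1, h2, h3, h4⟩ := hg
  have hb : ∀ x, |g1 x| ≤ 1 := fun x => by
    rw [← sq_le_one_iff_abs_le_one]; linarith [h3 x, h4 x]
  have hb2 : ∀ x, |g2 x| ≤ 1 := fun x => by
    rw [abs_of_nonneg (h3 x)]; nlinarith [h4 x, sq_nonneg (g1 x)]
  have hl := lip_of_deriv h2 hb2
  refine ⟨g1, fun x h => ?_, hb, hl⟩
  have hd : ∀ z, HasDerivAt (fun z => g z - g1 x * z) (g1 z - g1 x * 1) z := fun z =>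
    (h1 z).sub ((hasDerivAt_id z).const_mul (g1 x))
  have := (convex_uIcc x (x+h)).norm_image_sub_le_of_norm_hasDerivWithin_le
    (f := fun z => g z - g1 x * z) (f' := fun z => g1 z - g1 x * 1)
    (C := |h|) (x := x) (y := x + h) (fun z _ => (hd z).hasDerivWithinAt) (fun z hz => ?_)
    left_mem_uIcc right_mem_uIcc
  · simp only [norm_eq_abs, add_sub_cancel_left] at this
    rw [← sq_abs, pow_two]
    convert this using 2
    ring
  · rw [mul_one]
    refine (hl z x).trans ?_
    have := Set.abs_sub_left_of_mem_uIcc hz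
    simpa using this

lemma C1Q.hasDerivAt {f f1 : ℝ → ℝ} (h : C1Q f f1) (x : ℝ) : HasDerivAt f (f1 x) x := by
  rw [hasDerivAt_iff_isLittleO_nhds_zero]
  refine (Asymptotics.IsBigO.of_bound 1 (g := fun h : ℝ => h ^ 2) (.of_forall fun k => ?_)).trans_isLittleO ?_
  · have := h.1 x k
    simp only [norm_eq_abs, smul_eq_mul, abs_pow, sq_abs, one_mul]
    rwa [mul_comm k]
  · simpa using Asymptotics.isLittleO_pow_pow (𝕜 := ℝ) (m := 1) (n := 2) (by norm_num)

lemma C1Q.lip {f f1 : ℝ → ℝ} (h : C1Q f f1) (x y : ℝ) : |f x - f y| ≤ |x - y| :=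
  lip_of_deriv h.hasDerivAt h.2.1 x y

lemma C1Q.cont {f f1 : ℝ → ℝ} (h : C1Q f f1) : Continuous f :=
  continuous_iff_continuousAt.2 fun x => (h.hasDerivAt x).continuousAt

lemma C1Q.growth {f f1 : ℝ → ℝ} (h : C1Q f f1) (x y : ℝ) : |f (x + y)| ≤ |f x| + |y| := by
  have := h.lip (x + y) x
  rw [add_sub_cancel_left] at this
  have h2 := abs_sub_abs_le_abs_sub (f (x+y)) (f x)
  linarith

lemma C1Q.int {f f1 : ℝ → ℝ} (h : C1Q f f1) (τ x : ℝ) : Integrable (fun y => f (x + y)) (nG τ) :=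
  nG_int_lin (h.cont.measurable.comp (measurable_const_add x)) (h.growth x)

lemma C1Q.intexp {f f1 : ℝ → ℝ} (h : C1Q f f1) (m τ x : ℝ) :
    Integrable (fun y => Real.exp (m * f (x + y))) (nG τ) := by
  have := h.cont
  refine nG_int_exp (C := Real.exp (|m| * |f x|)) (c := |m|) (by fun_prop) fun y => ?_
  rw [abs_of_pos (Real.exp_pos _), ← Real.exp_add, Real.exp_le_exp]
  have h1 := h.growth x y
  have h2 := abs_mul m (f (x+y))
  have h3 := le_abs_self (m * f (x+y))
  nlinarith [abs_nonneg m]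

lemma nG_hasDerivAt {k k' : ℝ → ℝ} (hk : ∀ x, HasDerivAt k (k' x) x) {C : ℝ}
    (hb : ∀ x, |k x| ≤ C * Real.exp |x|) (hb' : ∀ x, |k' x| ≤ C * Real.exp |x|) (τ x : ℝ) :
    Integrable (fun y => k (x + y)) (nG τ) ∧ Integrable (fun y => k' (x + y)) (nG τ) ∧
    HasDerivAt (fun x => ∫ y, k (x + y) ∂(nG τ)) (∫ y, k' (x + y) ∂(nG τ)) x := by
  have hC : 0 ≤ C := by
    have := (abs_nonneg _).trans (hb 0)
    simpa using this
  have hkm : Measurable k :=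
    (continuous_iff_continuousAt.2 fun x => (hk x).continuousAt).measurable
  have hkm' : Measurable k' := by
    have : k' = deriv k := funext fun x => (hk x).deriv.symm
    rw [this]; exact measurable_deriv k
  have key : ∀ (f : ℝ → ℝ), (∀ x, |f x| ≤ C * Real.exp |x|) → ∀ z y, |z - x| ≤ 1 →
      |f (z + y)| ≤ C * Real.exp (|x| + 1) * Real.exp (1 * |y|) := by
    intro f hf z y hz
    refine (hf _).trans ?_
    rw [mul_assoc, ← Real.exp_add]
    refine mul_le_mul_of_nonneg_left (Real.exp_le_exp.2 ?_) hC
    have h1 := abs_add_le z y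
    have h2 := abs_add_le x (z - x)
    rw [add_sub_cancel] at h2
    linarith
  have i1 : Integrable (fun y => k (x + y)) (nG τ) :=
    nG_int_exp (hkm.comp (measurable_const_add x)) fun y => key k hb x y (by simp)
  refine ⟨i1, hasDerivAt_integral_of_dominated_loc_of_deriv_le (F := fun x y => k (x + y))
    (F' := fun x y => k' (x + y)) (s := Metric.ball x 1)
    (bound := fun y => C * Real.exp (|x| + 1) * Real.exp (1 * |y|)) (Metric.ball_mem_nhds x one_pos)
    (.of_forall fun z => (hkm.comp (measurable_const_add z)).aestronglyMeasurable) i1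
    ((hkm'.comp (measurable_const_add x)).aestronglyMeasurable)
    (.of_forall fun y z hz => ?_) ((nG_exp_abs τ 1).const_mul _) (.of_forall fun y z hz => ?_)⟩
  · exact key k' hb' z y (by simpa [Real.dist_eq] using (Metric.mem_ball.1 hz).le)
  · exact (hk (z + y)).comp_add_const z y

lemma int_lin3 {ν : Measure ℝ} {f g h : ℝ → ℝ} (hf : Integrable f ν) (hg : Integrable g ν)
    (hh : Integrable h ν) (c d : ℝ) :
    ∫ y, (f y - c * g y + d * h y) ∂ν = ∫ y, f y ∂ν - c * ∫ y, g y ∂ν + d * ∫ y, h y ∂ν := by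
  have h1 : Integrable (fun y => f y - c * g y) ν := hf.sub (hg.const_mul c)
  rw [integral_add h1 (hh.const_mul d), integral_sub hf (hg.const_mul c), integral_const_mul,
    integral_const_mul]

lemma gOp_reg {g : ℝ → ℝ} (hg : Reg g) {m : ℝ} (hm : 0 ≤ m) (hm1 : m ≤ 1) (τ : ℝ) :
    Reg (gOp m τ g) := by
  obtain ⟨f1, hc⟩ := hg.c1q
  obtain ⟨g1, g2, h1, h2, h3, h4⟩ := hg
  obtain rfl : f1 = g1 := funext fun x => (hc.hasDerivAt x).unique (h1 x)
  have hb := hc.2.1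
  have hb2 : ∀ x, |g2 x| ≤ 1 := fun x => by
    rw [abs_of_nonneg (h3 x)]; nlinarith [h4 x, sq_nonneg (f1 x)]
  have hgr : ∀ x, |g x| ≤ |g 0| + |x| := fun x => by simpa using hc.growth 0 x
  have hf1c : Continuous f1 := continuous_iff_continuousAt.2 fun x => (h2 x).continuousAt
  have hg2m : Measurable g2 := by
    have : g2 = deriv f1 := funext fun x => (h2 x).deriv.symm
    rw [this]; exact measurable_deriv f1
  rcases hm.eq_or_lt with rfl | hm
  · have e1 : ∀ x : ℝ, 1 ≤ Real.exp |x| := fun x => Real.one_le_exp (abs_nonneg x)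
    have e2 : ∀ x : ℝ, |x| ≤ Real.exp |x| := fun x => by linarith [Real.add_one_le_exp |x|]
    have D1 := nG_hasDerivAt h1 (C := |g 0| + 1) (fun x => by
      nlinarith [hgr x, e1 x, e2 x, abs_nonneg (g 0)]) (fun x => by
      nlinarith [hb x, e1 x, e2 x, abs_nonneg (g 0)]) τ
    have D2 := nG_hasDerivAt h2 (C := 1) (fun x => by
      nlinarith [hb x, e1 x]) (fun x => by nlinarith [hb2 x, e1 x]) τ
    have hT : gOp 0 τ g = fun x => ∫ y, g (x + y) ∂(nG τ) := by ext x; simp [gOp]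
    rw [hT]
    refine ⟨_, _, fun x => (D1 x).2.2, fun x => (D2 x).2.2,
      fun x => integral_nonneg fun y => h3 _, fun x => ?_⟩
    have iS : Integrable (fun y => f1 (x + y) ^ 2) (nG τ) :=
      (integrable_const (1:ℝ)).mono' (by fun_prop) (.of_forall fun y => by
        rw [norm_pow, sq_le_one_iff_abs_le_one, norm_eq_abs, abs_abs]; exact hb _)
    have s1 : ∫ y, g2 (x + y) ∂(nG τ) ≤ ∫ y, (1 - f1 (x + y) ^ 2) ∂(nG τ) :=
      integral_mono (D2 x).2.1 ((integrable_const _).sub iS) fun y => h4 _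
    rw [integral_sub (integrable_const _) iS] at s1
    set L := ∫ y, f1 (x + y) ∂(nG τ)
    have s2 : 0 ≤ ∫ y, (f1 (x + y) ^ 2 - (2 * L) * f1 (x + y) + L ^ 2 * 1) ∂(nG τ) :=
      integral_nonneg fun y => by
        have := sq_nonneg (f1 (x+y) - L)
        simp only [Pi.zero_apply]
        nlinarith
    rw [int_lin3 iS (D2 x).1 (integrable_const _)] at s2
    simp only [integral_const, probReal_univ, smul_eq_mul, one_mul, mul_one] at s1 s2
    change 0 ≤ _ - 2 * L * L + L ^ 2 at s2
    nlinarith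
  · -- positive m
    set C := Real.exp |g 0| * 2 with hC
    have eb : ∀ x, Real.exp (m * g x) ≤ Real.exp |g 0| * Real.exp |x| := fun x => by
      rw [← Real.exp_add, Real.exp_le_exp]
      have := hgr x
      have h6 := le_abs_self (g x)
      have h7 := abs_nonneg (g x)
      nlinarith
    have k0d : ∀ x, HasDerivAt (fun x => Real.exp (m * g x))
        (m * (f1 x * Real.exp (m * g x))) x := fun x => by
      convert ((h1 x).const_mul m).exp using 1; ring
    have k1d : ∀ x, HasDerivAt (fun x => m * (f1 x * Real.exp (m * g x)))
        (m * (g2 x * Real.exp (m * g x) + f1 x * (m * (f1 x * Real.exp (m * g x))))) x := fun x =>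
      ((h2 x).mul (k0d x)).const_mul m
    have b0 : ∀ x, |Real.exp (m * g x)| ≤ C * Real.exp |x| := fun x => by
      rw [abs_of_pos (Real.exp_pos _)]
      have := eb x
      have := Real.exp_pos (m * g x)
      rw [hC]; nlinarith
    have b1 : ∀ x, |m * (f1 x * Real.exp (m * g x))| ≤ C * Real.exp |x| := fun x => by
      refine le_trans ?_ (b0 x)
      rw [abs_mul, abs_mul, ← mul_assoc]
      refine mul_le_of_le_one_left (abs_nonneg _) ?_
      rw [abs_of_pos hm]
      nlinarith [hb x, abs_nonneg (f1 x)]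
    have b2 : ∀ x, |m * (g2 x * Real.exp (m * g x) + f1 x * (m * (f1 x * Real.exp (m * g x))))|
        ≤ C * Real.exp |x| := fun x => by
      have e : m * (g2 x * Real.exp (m * g x) + f1 x * (m * (f1 x * Real.exp (m * g x)))) =
        (m * (g2 x + m * f1 x ^ 2)) * Real.exp (m * g x) := by ring
      have h5 : 0 ≤ m * f1 x ^ 2 := by positivity
      have h6 : 0 ≤ g2 x + m * f1 x ^ 2 := by linarith [h3 x]
      rw [e, abs_of_nonneg (mul_nonneg (mul_nonneg hm.le h6) (Real.exp_pos _).le)]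
      have h8 : g2 x + m * f1 x ^ 2 ≤ 1 := by nlinarith [h4 x, sq_nonneg (f1 x)]
      have h9 : m * (g2 x + m * f1 x ^ 2) ≤ 1 := by nlinarith
      have := eb x
      have := Real.exp_pos (m * g x)
      rw [hC]; nlinarith
    have D1 := nG_hasDerivAt k0d b0 b1 τ
    have D2 := nG_hasDerivAt k1d b1 b2 τ
    have hT : gOp m τ g = fun x => m⁻¹ * Real.log (∫ y, Real.exp (m * g (x + y)) ∂(nG τ)) := by
      ext x; simp [gOp, hm.ne']
    have hpos : ∀ x, 0 < ∫ y, Real.exp (m * g (x + y)) ∂(nG τ) := fun x =>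
      integral_exp_pos (D1 x).1
    rw [hT]
    refine ⟨_, _, fun x => ((D1 x).2.2.log (hpos x).ne').const_mul m⁻¹,
      fun x => (((D2 x).2.2).div (D1 x).2.2 (hpos x).ne').const_mul m⁻¹, ?_⟩
    have key : ∀ x, ∃ L S : ℝ, 
        (∫ y, m * (f1 (x + y) * Real.exp (m * g (x + y))) ∂(nG τ)) = m * L ∧
        L ^ 2 ≤ S * (∫ y, Real.exp (m * g (x + y)) ∂(nG τ)) ∧
        m ^ 2 * S ≤ (∫ y, m * (g2 (x + y) * Real.exp (m * g (x + y)) + f1 (x + y) * (m * (f1 (x + y) * Real.exp (m * g (x + y))))) ∂(nG τ)) ∧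
        (∫ y, m * (g2 (x + y) * Real.exp (m * g (x + y)) + f1 (x + y) * (m * (f1 (x + y) * Real.exp (m * g (x + y))))) ∂(nG τ)) ≤ m * (∫ y, Real.exp (m * g (x + y)) ∂(nG τ)) - m * (1 - m) * S := by
      intro x
      have i0 := (D1 x).1
      have iL : Integrable (fun y => f1 (x + y) * Real.exp (m * g (x + y))) (nG τ) := by
        refine i0.bdd_mul (c := 1) (by fun_prop) (.of_forall fun y => hb _)
      have iS : Integrable (fun y => f1 (x + y) ^ 2 * Real.exp (m * g (x + y))) (nG τ) := by
        refine i0.bdd_mul (c := 1) (by fun_prop) (.of_forall fun y => ?_)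
        rw [norm_pow, sq_le_one_iff_abs_le_one, norm_eq_abs, abs_abs]; exact hb _
      refine ⟨∫ y, f1 (x + y) * Real.exp (m * g (x + y)) ∂(nG τ),
        ∫ y, f1 (x + y) ^ 2 * Real.exp (m * g (x + y)) ∂(nG τ), integral_const_mul _ _, ?_, ?_, ?_⟩
      · set L := ∫ y, f1 (x + y) * Real.exp (m * g (x + y)) ∂(nG τ) with hL
        set h0 := ∫ y, Real.exp (m * g (x + y)) ∂(nG τ) with hh0
        have h0p : 0 < h0 := hpos x
        have s2 : 0 ≤ ∫ y, (f1 (x + y) ^ 2 * Real.exp (m * g (x + y)) - (2 * (L / h0)) * (f1 (x + y) * Real.exp (m * g (x + y))) + (L / h0) ^ 2 * Real.exp (m * g (x + y))) ∂(nG τ) :=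
          integral_nonneg fun y => by
            have := mul_nonneg (sq_nonneg (f1 (x+y) - L / h0)) (Real.exp_pos (m * g (x + y))).le
            simp only [Pi.zero_apply]
            nlinarith
        rw [int_lin3 iS iL i0, ← hL, ← hh0] at s2
        have : 2 * (L / h0) * L - (L/h0)^2 * h0 = L^2 / h0 := by field_simp; ring
        have h5 : L^2 / h0 ≤ ∫ y, f1 (x + y) ^ 2 * Real.exp (m * g (x + y)) ∂(nG τ) := by linarith
        rwa [div_le_iff₀ h0p] at h5
      · rw [← integral_const_mul]
        refine integral_mono (iS.const_mul _) (D2 x).2.1 fun y => ?_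
        have := mul_nonneg (mul_nonneg hm.le (h3 (x + y))) (Real.exp_pos (m * g (x + y))).le
        simp only
        nlinarith
      · rw [← integral_const_mul, ← integral_const_mul, ← integral_sub (i0.const_mul _) (iS.const_mul _)]
        refine integral_mono (D2 x).2.1 ((i0.const_mul _).sub (iS.const_mul _)) fun y => ?_
        have := mul_nonneg (mul_nonneg hm.le (sub_nonneg.2 (h4 (x + y)))) (Real.exp_pos (m * g (x + y))).le
        simp only
        nlinarith
    constructor
    · intro x
      obtain ⟨L, S, e1, e2, e3, e4⟩ := key x
      rw [e1]
      have := hpos x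
      refine mul_nonneg (inv_nonneg.2 hm.le) (div_nonneg ?_ (sq_nonneg _))
      nlinarith [mul_le_mul_of_nonneg_left e2 (sq_nonneg m)]
    · intro x
      obtain ⟨L, S, e1, e2, e3, e4⟩ := key x
      rw [e1]
      set h0 := ∫ y, Real.exp (m * g (x + y)) ∂(nG τ)
      have h0p : 0 < h0 := hpos x
      set H2 := (∫ y, m * (g2 (x + y) * Real.exp (m * g (x + y)) + f1 (x + y) * (m * (f1 (x + y) * Real.exp (m * g (x + y))))) ∂(nG τ))
      rw [← sub_nonneg]
      have : 1 - (m⁻¹ * (m * L / h0)) ^ 2 - m⁻¹ * ((H2 * h0 - m * L * (m * L)) / h0 ^ 2) =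
        ((m * h0 - H2) * h0 - m * (1 - m) * L ^ 2) / (m * h0 ^ 2) := by
        field_simp
        ring
      rw [this]
      refine div_nonneg ?_ (by positivity)
      have h5 : 0 ≤ m * (1 - m) := mul_nonneg hm.le (by linarith)
      nlinarith [mul_le_mul_of_nonneg_left e2 h5]

lemma reg_logcosh : Reg (fun x => Real.log (Real.cosh x)) := by
  have hc : ∀ x, Real.cosh x ≠ 0 := fun x => (Real.cosh_pos x).ne'
  refine ⟨fun x => Real.sinh x / Real.cosh x, _, fun x => (Real.hasDerivAt_cosh x).log (hc x),
    fun x => (Real.hasDerivAt_sinh x).div (Real.hasDerivAt_cosh x) (hc x), fun x => ?_, fun x => ?_⟩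
  · have := Real.cosh_sq x
    exact div_nonneg (by nlinarith) (sq_nonneg _)
  · have := Real.cosh_sq x
    have h1 := hc x
    apply le_of_eq
    field_simp


lemma C1Q.gOp_pos_int {g g1 : ℝ → ℝ} (hg : C1Q g g1) (m τ x : ℝ) :
    0 < ∫ y, Real.exp (m * g (x + y)) ∂(nG τ) := integral_exp_pos (hg.intexp m τ x)

lemma gOp_semi {g g1 : ℝ → ℝ} (hg : C1Q g g1) (m : ℝ) {τ₁ τ₂ : ℝ} (h₁ : 0 ≤ τ₁) (h₂ : 0 ≤ τ₂)
    (x : ℝ) : gOp m τ₁ (gOp m τ₂ g) x = gOp m (τ₁ + τ₂) g x := by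
  by_cases hm : m = 0
  · simp only [gOp, hm, if_true]
    rw [nG_conv h₁ h₂ (hg.int _ x)]
    simp only [add_assoc]
  · simp only [gOp, hm, if_false]
    rw [nG_conv h₁ h₂ (hg.intexp m _ x)]
    congr 2
    refine integral_congr_ae (.of_forall fun y => ?_)
    beta_reduce
    rw [← mul_assoc, mul_inv_cancel₀ hm, one_mul, Real.exp_log (hg.gOp_pos_int m τ₂ (x + y))]
    simp only [add_assoc]

lemma gOp_gibbs {g g1 : ℝ → ℝ} (hg : C1Q g g1) {m τ : ℝ} (hm : 0 ≤ m) (hτ : 0 ≤ τ) (c x : ℝ) :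
    ∫ y, g (x + c * (m * τ) + y) ∂(nG τ) - 1 / 2 * c ^ 2 * (m * τ) ≤ gOp m τ g x := by
  rcases hm.eq_or_lt with rfl | hm
  · simp [gOp]
  have hcont := hg.cont
  simp only [gOp, hm.ne', if_false]
  rw [nG_shift hτ (c * m) (fun y => Real.exp (m * g (x + y)))]
  set K : ℝ → ℝ := fun y => m * g (x + c * (m * τ) + y) - (c * m) * y + (-((c*m) ^ 2 * τ / 2)) * 1 with hK
  have e : ∀ y, Real.exp (m * g (x + (y + c * m * τ))) *
      Real.exp (-(c * m * y) - (c * m) ^ 2 * τ / 2) = Real.exp (K y) := fun y => by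
    rw [← Real.exp_add, hK]
    have : x + (y + c * m * τ) = x + c * (m * τ) + y := by ring
    rw [this]
    congr 1; ring
  simp only [e]
  have iK : ∫ y, K y ∂(nG τ) = m * ∫ y, g (x + c * (m * τ) + y) ∂(nG τ) - (c*m)^2 * τ / 2 := by
    rw [hK, int_lin3 ((hg.int τ _).const_mul m) (nG_int_id τ) (integrable_const _), nG_mean,
      integral_const_mul]
    simp
    ring
  have iiK : Integrable K (nG τ) :=
    (((hg.int τ _).const_mul m).sub ((nG_int_id τ).const_mul _)).add (integrable_const _)
  have iE : Integrable (fun y => Real.exp (K y)) (nG τ) := by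
    refine nG_int_exp (C := Real.exp (m * |g (x + c * (m * τ))|)) (c := m + |c * m|) (by fun_prop) fun y => ?_
    rw [abs_of_pos (Real.exp_pos _), ← Real.exp_add, Real.exp_le_exp, hK]
    have h1 := hg.growth (x + c * (m * τ)) y
    have h2 := neg_abs_le (c * m * y)
    rw [abs_mul] at h2
    have h3 := mul_le_mul_of_nonneg_left ((le_abs_self _).trans h1) hm.le
    have h4 : 0 ≤ (c * m) ^ 2 * τ / 2 := by positivity
    nlinarith
  have J := convexOn_exp.map_integral_le (μ := nG τ) (f := K) Real.continuous_exp.continuousOn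
    isClosed_univ (.of_forall fun _ => trivial) iiK iE
  have J2 := (Real.le_log_iff_exp_le ((Real.exp_pos _).trans_le J)).2 J
  rw [iK] at J2
  have J3 := mul_le_mul_of_nonneg_left J2 (inv_nonneg.2 hm.le)
  refine le_trans (le_of_eq ?_) J3
  field_simp

/-- modulus -/
def wG (τ : ℝ) : ℝ := ∫ y, |y| * Real.exp |y| ∂(nG τ)

lemma wG_integrable (τ c : ℝ) : Integrable (fun y => |y| * Real.exp (c * |y|)) (nG τ) := by
  refine nG_int_exp (C := 1) (c := 1 + c) (by fun_prop) fun y => ?_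
  rw [abs_of_nonneg (by positivity), one_mul, add_mul, Real.exp_add, one_mul]
  exact mul_le_mul_of_nonneg_right (by linarith [Real.add_one_le_exp |y|]) (Real.exp_pos _).le

lemma gOp_near {g g1 : ℝ → ℝ} (hg : C1Q g g1) {m τ : ℝ} (hm : 0 ≤ m) (hm1 : m ≤ 1) (hτ : 0 ≤ τ)
    (x : ℝ) : |gOp m τ g x - g x| ≤ wG τ := by
  have hw : Integrable (fun y => |y| * Real.exp |y|) (nG τ) := by simpa using wG_integrable τ 1
  have hw1 : ∀ y : ℝ, |y| ≤ |y| * Real.exp |y| := fun y =>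
    le_mul_of_one_le_right (abs_nonneg y) (Real.one_le_exp (abs_nonneg y))
  have hlip : ∀ y, |g (x + y) - g x| ≤ |y| := fun y => by simpa using hg.lip (x + y) x
  have hdiff : |∫ y, g (x + y) ∂(nG τ) - g x| ≤ wG τ := by
    have : ∫ y, g (x + y) ∂(nG τ) - g x = ∫ y, (g (x + y) - g x) ∂(nG τ) := by
      rw [integral_sub (hg.int τ x) (integrable_const _)]; simp
    rw [this]
    refine (abs_integral_le_integral_abs).trans (integral_mono ?_ hw fun y => (hlip y).trans (hw1 y))
    exact ((hg.int τ x).sub (integrable_const _)).abs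
  rcases hm.eq_or_lt with rfl | hm
  · simpa [gOp] using hdiff
  rw [abs_le]
  constructor
  · have := gOp_gibbs hg hm.le hτ 0 x
    simp only [zero_mul, add_zero] at this
    have := (abs_le.1 hdiff).1
    norm_num at *
    linarith
  · simp only [gOp, hm.ne', if_false]
    have hI := hg.gOp_pos_int m τ x
    have e1 : ∀ y, Real.exp (m * g (x + y)) ≤
        Real.exp (m * g x) * (1 + m * (|y| * Real.exp |y|)) := fun y => by
      have h1 : m * g (x + y) ≤ m * g x + m * |y| := by
        rw [← mul_add]; exact mul_le_mul_of_nonneg_left (by linarith [(abs_le.1 (hlip y)).2]) hm.le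
      refine (Real.exp_le_exp.2 h1).trans ?_
      rw [Real.exp_add]
      refine mul_le_mul_of_nonneg_left ?_ (Real.exp_pos _).le
      have h2 : 0 ≤ m * |y| := by positivity
      have h3 : Real.exp (m * |y|) ≤ 1 + m * |y| * Real.exp (m * |y|) := by
        have := Real.add_one_le_exp (-(m * |y|))
        have h5 := mul_le_mul_of_nonneg_right this (Real.exp_pos (m * |y|)).le
        rw [← Real.exp_add] at h5
        simp at h5
        nlinarith
      have h4 : Real.exp (m * |y|) ≤ Real.exp |y| := Real.exp_le_exp.2 (by nlinarith [abs_nonneg y])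
      nlinarith [mul_le_mul_of_nonneg_left h4 h2]
    have e2 : ∫ y, Real.exp (m * g (x + y)) ∂(nG τ) ≤ Real.exp (m * g x) * (1 + m * wG τ) := by
      have i2 : Integrable (fun y => 1 + m * (|y| * Real.exp |y|)) (nG τ) :=
        (integrable_const _).add (hw.const_mul m)
      refine (integral_mono (hg.intexp m τ x) (i2.const_mul _) e1).trans (le_of_eq ?_)
      rw [integral_const_mul, integral_add (integrable_const _) (hw.const_mul m), integral_const_mul]
      simp [wG]
    have hw0 : 0 ≤ wG τ := integral_nonneg fun y => by positivity
    have e3 := Real.log_le_log hI e2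
    rw [Real.log_mul (Real.exp_pos _).ne' (by positivity), Real.log_exp] at e3
    have e4 : Real.log (1 + m * wG τ) ≤ m * wG τ := by
      have := Real.log_le_sub_one_of_pos (by positivity : 0 < 1 + m * wG τ)
      linarith
    have e5 := mul_le_mul_of_nonneg_left (e3.trans (add_le_add_right e4 _)) (inv_nonneg.2 hm.le)
    have : m⁻¹ * (m * g x + m * wG τ) = g x + wG τ := by field_simp
    linarith

lemma wG_le {τ T : ℝ} (h : 0 ≤ τ) (hT : τ ≤ T) :
    wG τ ≤ (∫ z, |z| * Real.exp (Real.sqrt T * |z|) ∂(nG 1)) * Real.sqrt τ := by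
  have h1 : nG 1 = gaussianReal 0 1 := by simp [nG]
  unfold wG
  rw [nG_scale h (by fun_prop), ← integral_mul_const, ← h1]
  have hs := Real.sqrt_nonneg τ
  have hsT := Real.sqrt_le_sqrt hT
  refine integral_mono_of_nonneg (.of_forall fun z => by positivity)
    ((wG_integrable 1 _).mul_const _) (.of_forall fun z => ?_)
  simp only [abs_mul, abs_of_nonneg hs]
  rw [mul_right_comm]
  refine mul_le_mul_of_nonneg_right (mul_le_mul_of_nonneg_left (Real.exp_le_exp.2 ?_) (abs_nonneg z)) hs
  rw [mul_comm]
  exact mul_le_mul_of_nonneg_right hsT (abs_nonneg z)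

/-! ### distribution functions -/
lemma distF_mono {μ : Measure ℝ} (hμ : MemM μ) : Monotone (distF μ) := fun a b h => by
  have := hμ.1
  exact ENNReal.toReal_mono (measure_ne_top _ _) (measure_mono (Icc_subset_Icc_right h))

lemma distF_nonneg (μ : Measure ℝ) (r : ℝ) : 0 ≤ distF μ r := ENNReal.toReal_nonneg

lemma distF_le_one {μ : Measure ℝ} (hμ : MemM μ) (r : ℝ) : distF μ r ≤ 1 := by
  have := hμ.1
  have h : μ (Icc 0 r) ≤ 1 := prob_le_one
  simpa [distF] using ENNReal.toReal_mono ENNReal.one_ne_top h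

lemma w_int {β : ℕ → ℝ} (hβ : ValidBeta β) {μ : Measure ℝ} (hμ : MemM μ) {a b : ℝ}
    (ha : a ∈ Icc (0:ℝ) 1) (hb : b ∈ Icc (0:ℝ) 1) :
    IntervalIntegrable (fun r => distF μ r * zetaFn β r) volume a b := by
  have hz : IntervalIntegrable (zetaFn β) volume a b :=
    ((zeta_continuousOn hβ).mono (uIcc_subset_Icc ha hb)).intervalIntegrable
  rw [intervalIntegrable_iff] at hz ⊢
  refine hz.bdd_mul (c := 1) (distF_mono hμ).measurable.aestronglyMeasurable
    (.of_forall fun r => ?_)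
  rw [norm_of_nonneg (distF_nonneg _ _)]
  exact distF_le_one hμ r

/-! ### atomic measures -/
section atomic
variable {β : ℕ → ℝ} {ν : Measure ℝ} {φ : ℝ → ℝ → ℝ} {S : Finset ℝ}

lemma nextPt_mem (hS : ν ((S : Set ℝ))ᶜ = 0) (a : ℝ) :
    nextPt ν a ∈ ({q : ℝ | a < q ∧ q ≤ 1 ∧ ν {q} ≠ 0} ∪ {1}) := by
  refine Set.Nonempty.csInf_mem ⟨1, by simp⟩ ((insert 1 S).finite_toSet.subset ?_)
  rintro q (hq | hq)
  · have : q ∈ S := by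
      by_contra h
      exact hq.2.2 (measure_mono_null (by simpa using h) hS)
    simp [this]
  · simp at hq; simp [hq]

lemma nextPt_le {a q : ℝ} (ha : a ≤ 1)
    (h : q ∈ ({q : ℝ | a < q ∧ q ≤ 1 ∧ ν {q} ≠ 0} ∪ {1})) : nextPt ν a ≤ q := by
  refine csInf_le ⟨a, ?_⟩ h
  rintro q (hq | hq)
  · exact hq.1.le
  · simp at hq; linarith

lemma nextPt_mem_S (hS : ν ((S : Set ℝ))ᶜ = 0) (a : ℝ) : nextPt ν a ∈ insert 1 S := by
  rcases nextPt_mem hS a with hq | hq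
  · have : nextPt ν a ∈ S := by
      by_contra h
      exact hq.2.2 (measure_mono_null (by simpa using h) hS)
    simp [this]
  · simp at hq; simp [hq]

lemma lt_nextPt (hS : ν ((S : Set ℝ))ᶜ = 0) {a : ℝ} (ha : a < 1) : a < nextPt ν a := by
  rcases nextPt_mem hS a with hq | hq
  · exact hq.1
  · simp at hq; linarith

lemma nextPt_le_one (hS : ν ((S : Set ℝ))ᶜ = 0) (a : ℝ) : nextPt ν a ≤ 1 := by
  rcases nextPt_mem hS a with hq | hq
  · exact hq.2.1
  · simp at hq; linarith

lemma nextPt_eq (hS : ν ((S : Set ℝ))ᶜ = 0) {a b : ℝ} (hab : a ≤ b) (hb : b < nextPt ν a) :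
    nextPt ν b = nextPt ν a := by
  have h1 := nextPt_le_one hS a
  apply le_antisymm
  · refine nextPt_le (by linarith) ?_
    rcases nextPt_mem hS a with hq | hq
    · exact Or.inl ⟨hb, hq.2⟩
    · exact Or.inr hq
  · refine nextPt_le (by linarith) ?_
    rcases nextPt_mem hS b with hq | hq
    · exact Or.inl ⟨hab.trans_lt hq.1, hq.2⟩
    · exact Or.inr hq

lemma distF_eq (hν : MemM ν) (hS : ν ((S : Set ℝ))ᶜ = 0) {a b : ℝ} (ha : 0 ≤ a) (hab : a ≤ b)
    (hb : b < nextPt ν a) : distF ν b = distF ν a := by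
  have h1 := nextPt_le_one hS a
  unfold distF
  rw [← Icc_union_Ioc_eq_Icc ha hab]
  have hz : ν (Ioc a b) = 0 := by
    refine measure_mono_null (t := (S : Set ℝ)ᶜ ∪ ⋃ q ∈ (S.filter (· ∈ Ioc a b) : Set ℝ), {q}) ?_ ?_
    · intro q hq
      by_cases h : q ∈ S
      · right; simp only [mem_iUnion]; exact ⟨q, by simpa [h] using hq, rfl⟩
      · left; exact h
    · refine measure_union_null hS ((measure_biUnion_null_iff (Finset.countable_toSet _)).2 ?_)
      intro q hq
      simp only [Finset.coe_filter, mem_setOf_eq] at hq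
      by_contra h
      have := nextPt_le (ν := ν) (a := a) (q := q) (by linarith)
        (Or.inl ⟨hq.2.1, by linarith [hq.2.2], h⟩)
      linarith [hq.2.2]
  rw [le_antisymm ((measure_union_le _ _).trans (by rw [hz, add_zero])) (measure_mono subset_union_left)]
end atomic


section atomic2
variable {β : ℕ → ℝ} {ν : Measure ℝ} {φ : ℝ → ℝ → ℝ} {S : Finset ℝ}

lemma atom_ind (hS : ν ((S : Set ℝ))ᶜ = 0) {Q : ℝ → Prop} (h1 : Q 1)
    (h : ∀ a, 0 ≤ a → a < 1 → Q (nextPt ν a) → Q a) : ∀ a ∈ Icc (0:ℝ) 1, Q a := by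
  have key : ∀ n : ℕ, ∀ a ∈ Icc (0:ℝ) 1, ((insert 1 S).filter (a < ·)).card = n → Q a := by
    intro n
    induction n using Nat.strong_induction_on with
    | _ n ih =>
      intro a ha hn
      rcases ha.2.eq_or_lt with rfl | ha1
      · exact h1
      · have hlt := lt_nextPt hS ha1
        refine h a ha.1 ha1 (ih _ ?_ _ ⟨ha.1.trans hlt.le, nextPt_le_one hS a⟩ rfl)
        rw [← hn]
        apply Finset.card_lt_card
        rw [Finset.ssubset_iff_of_subset]
        · refine ⟨nextPt ν a, ?_, ?_⟩
          · simp only [Finset.mem_filter]; exact ⟨nextPt_mem_S hS a, hlt⟩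
          · simp
        · intro q hq
          simp only [Finset.mem_filter] at hq ⊢
          exact ⟨hq.1, hlt.trans hq.2⟩
  exact fun a ha => key _ a ha rfl

lemma atom_chain (hS : ν ((S : Set ℝ))ᶜ = 0) {R : ℝ → ℝ → Prop}
    (step : ∀ a b, 0 ≤ a → a < b → b ≤ nextPt ν a → R a b)
    (trans : ∀ a c b, 0 ≤ a → a < c → c < b → b ≤ 1 → R a c → R c b → R a b)
    {a b : ℝ} (ha : 0 ≤ a) (hab : a < b) (hb : b ≤ 1) : R a b := by
  have := atom_ind hS (Q := fun a => ∀ b, a < b → b ≤ 1 → R a b)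
    (fun b h h' => absurd h (not_lt.2 h')) ?_ a ⟨ha, by linarith⟩ b hab hb
  · exact this
  · intro a ha ha1 ih b hab hb
    by_cases h : b ≤ nextPt ν a
    · exact step a b ha hab h
    · have hlt := lt_nextPt hS ha1
      exact trans a _ b ha hlt (not_le.1 h) hb (step a _ ha hlt le_rfl) (ih b (not_le.1 h) hb)


lemma atom_gstep (hβ : ValidBeta β) (hν : MemM ν) (hS : ν ((S : Set ℝ))ᶜ = 0) (hφ : IsAtomicSol β ν φ)
    {a : ℝ} (ha : 0 ≤ a) (ha1 : a < 1) (hm : Measurable (φ (nextPt ν a))) :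
    φ a = gOp (distF ν a) (xiD β (nextPt ν a) - xiD β a) (φ (nextPt ν a)) := by
  funext x
  have hlt := lt_nextPt hS ha1
  have hτ : 0 ≤ xiD β (nextPt ν a) - xiD β a :=
    sub_nonneg.2 (xiD_mono hβ ⟨ha, ha1.le⟩ ⟨ha.trans hlt.le, nextPt_le_one hS a⟩ hlt.le)
  rw [hφ.2 a ⟨ha, ha1⟩ x, gStep, gOp]
  rw [nG_scale hτ (f := fun y => φ (nextPt ν a) (x + y)) (by fun_prop),
    nG_scale hτ (f := fun y => Real.exp (distF ν a * φ (nextPt ν a) (x + y))) (by fun_prop)]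

lemma atom_reg (hβ : ValidBeta β) (hν : MemM ν) (hS : ν ((S : Set ℝ))ᶜ = 0) (hφ : IsAtomicSol β ν φ)
    : ∀ a ∈ Icc (0:ℝ) 1, Reg (φ a) := by
  refine atom_ind hS ?_ ?_
  · have : φ 1 = fun x => Real.log (Real.cosh x) := funext hφ.1
    rw [this]; exact reg_logcosh
  · intro a ha ha1 ih
    obtain ⟨g1, hg1⟩ := ih.c1q
    rw [atom_gstep hβ hν hS hφ ha ha1 hg1.cont.measurable]
    exact gOp_reg ih (distF_nonneg _ _) (distF_le_one hν _) _

lemma atom_step (hβ : ValidBeta β) (hν : MemM ν) (hS : ν ((S : Set ℝ))ᶜ = 0) (hφ : IsAtomicSol β ν φ)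
    {a b : ℝ} (ha : 0 ≤ a) (hab : a < b) (hb : b ≤ nextPt ν a) :
    φ a = gOp (distF ν a) (xiD β b - xiD β a) (φ b) := by
  have hn1 := nextPt_le_one hS a
  have hn : nextPt ν a ∈ Icc (0:ℝ) 1 := ⟨by linarith, hn1⟩
  have hbI : b ∈ Icc (0:ℝ) 1 := ⟨by linarith, by linarith⟩
  have haI : a ∈ Icc (0:ℝ) 1 := ⟨by linarith, by linarith⟩
  obtain ⟨g1, hg1⟩ := (atom_reg hβ hν hS hφ _ hn).c1q
  have e := atom_gstep hβ hν hS hφ ha (by linarith) hg1.cont.measurable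
  rcases hb.eq_or_lt with rfl | hlt
  · exact e
  · have en := nextPt_eq hS hab.le hlt
    have e2 := atom_gstep hβ hν hS hφ (a := b) (by linarith) (by linarith)
      (by rw [en]; exact hg1.cont.measurable)
    rw [en, distF_eq hν hS ha hab.le hlt] at e2
    rw [e, e2]
    funext x
    rw [gOp_semi hg1 _ (sub_nonneg.2 (xiD_mono hβ haI hbI hab.le))
      (sub_nonneg.2 (xiD_mono hβ hbI hn hlt.le))]
    congr 1; ring

lemma atom_A (hβ : ValidBeta β) (hν : MemM ν) (hS : ν ((S : Set ℝ))ᶜ = 0) (hφ : IsAtomicSol β ν φ)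
    {a b : ℝ} (ha : 0 ≤ a) (hab : a < b) (hb : b ≤ nextPt ν a) :
    ∫ r in a..b, distF ν r * zetaFn β r = distF ν a * (xiD β b - xiD β a) := by
  have hn1 := nextPt_le_one hS a
  rw [← integral_zeta hβ ⟨ha, by linarith⟩ ⟨by linarith, by linarith⟩,
    ← intervalIntegral.integral_const_mul, intervalIntegral.integral_of_le hab.le,
    intervalIntegral.integral_of_le hab.le, integral_Ioc_eq_integral_Ioo, integral_Ioc_eq_integral_Ioo]
  refine setIntegral_congr_fun measurableSet_Ioo fun r hr => ?_
  rw [distF_eq hν hS ha hr.1.le (hr.2.trans_le hb)]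

/-- the deterministic one-step inequality for constant controls -/
lemma atom_ineq (hβ : ValidBeta β) (hν : MemM ν) (hS : ν ((S : Set ℝ))ᶜ = 0) (hφ : IsAtomicSol β ν φ)
    {a b : ℝ} (ha : 0 ≤ a) (hab : a < b) (hb : b ≤ 1) : ∀ z c : ℝ,
    ∫ y, φ b (z + c * (∫ r in a..b, distF ν r * zetaFn β r) + y) ∂(nG (xiD β b - xiD β a))
      - 1 / 2 * c ^ 2 * (∫ r in a..b, distF ν r * zetaFn β r) ≤ φ a z := by
  refine atom_chain hS (R := fun a b => ∀ z c : ℝ,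
    ∫ y, φ b (z + c * (∫ r in a..b, distF ν r * zetaFn β r) + y) ∂(nG (xiD β b - xiD β a))
      - 1 / 2 * c ^ 2 * (∫ r in a..b, distF ν r * zetaFn β r) ≤ φ a z) ?_ ?_ ha hab hb
  · intro a b ha hab hb z c
    have hn1 := nextPt_le_one hS a
    have haI : a ∈ Icc (0:ℝ) 1 := ⟨by linarith, by linarith⟩
    have hbI : b ∈ Icc (0:ℝ) 1 := ⟨by linarith, by linarith⟩
    obtain ⟨g1, hg1⟩ := (atom_reg hβ hν hS hφ _ hbI).c1q
    rw [atom_A hβ hν hS hφ ha hab hb, atom_step hβ hν hS hφ ha hab hb]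
    exact gOp_gibbs hg1 (distF_nonneg _ _) (sub_nonneg.2 (xiD_mono hβ haI hbI hab.le)) c z
  · intro a c b ha hac hcb hb h1 h2 z k
    have haI : a ∈ Icc (0:ℝ) 1 := ⟨by linarith, by linarith⟩
    have hbI : b ∈ Icc (0:ℝ) 1 := ⟨by linarith, by linarith⟩
    have hcI : c ∈ Icc (0:ℝ) 1 := ⟨by linarith, by linarith⟩
    obtain ⟨g1, hg1⟩ := (atom_reg hβ hν hS hφ _ hbI).c1q
    obtain ⟨f1, hf1⟩ := (atom_reg hβ hν hS hφ _ hcI).c1q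
    have i1 := w_int hβ hν haI hcI
    have i2 := w_int hβ hν hcI hbI
    rw [← intervalIntegral.integral_add_adjacent_intervals i1 i2]
    set A1 := ∫ r in a..c, distF ν r * zetaFn β r
    set A2 := ∫ r in c..b, distF ν r * zetaFn β r
    have p1 : 0 ≤ xiD β c - xiD β a := sub_nonneg.2 (xiD_mono hβ haI hcI hac.le)
    have p2 : 0 ≤ xiD β b - xiD β c := sub_nonneg.2 (xiD_mono hβ hcI hbI hcb.le)
    have e : xiD β b - xiD β a = (xiD β c - xiD β a) + (xiD β b - xiD β c) := by ring
    rw [e, nG_conv p1 p2 (hg1.int _ _)]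
    have k1 : ∀ y₁, ∫ y₂, φ b (z + k * (A1 + A2) + (y₁ + y₂)) ∂(nG (xiD β b - xiD β c)) ≤
        φ c (z + k * A1 + y₁) + 1 / 2 * k ^ 2 * A2 := fun y₁ => by
      have := h2 (z + k * A1 + y₁) k
      have e2 : ∀ y₂, z + k * (A1 + A2) + (y₁ + y₂) = z + k * A1 + y₁ + k * A2 + y₂ := fun y => by ring
      simp only [e2]
      linarith
    have h3 := h1 z k
    have iF : Integrable (fun y => φ c (z + k * A1 + y) + 1 / 2 * k ^ 2 * A2) (nG (xiD β c - xiD β a)) :=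
      (hf1.int _ _).add (integrable_const _)
    have iG : Integrable (fun y₁ => ∫ y₂, φ b (z + k * (A1 + A2) + (y₁ + y₂)) ∂(nG (xiD β b - xiD β c)))
        (nG (xiD β c - xiD β a)) := by
      have hlip : ∀ y₁ y₁', |∫ y₂, φ b (z + k * (A1 + A2) + (y₁ + y₂)) ∂(nG (xiD β b - xiD β c)) -
          ∫ y₂, φ b (z + k * (A1 + A2) + (y₁' + y₂)) ∂(nG (xiD β b - xiD β c))| ≤ |y₁ - y₁'| := by
        intro y y'
        have j : ∀ y, Integrable (fun y₂ => φ b (z + k * (A1 + A2) + (y + y₂))) (nG (xiD β b - xiD β c)) :=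
          fun y => by simpa only [add_assoc] using hg1.int (xiD β b - xiD β c) (z + k * (A1 + A2) + y)
        rw [← integral_sub (j y) (j y')]
        have hb : ∀ y₂, ‖φ b (z + k * (A1 + A2) + (y + y₂)) - φ b (z + k * (A1 + A2) + (y' + y₂))‖
            ≤ |y - y'| := fun y₂ => by
          refine (hg1.lip _ _).trans_eq ?_
          congr 1; ring
        simpa using norm_integral_le_of_norm_le_const (μ := nG (xiD β b - xiD β c)) (.of_forall hb)
      have hc : Continuous (fun y₁ => ∫ y₂, φ b (z + k * (A1 + A2) + (y₁ + y₂)) ∂(nG (xiD β b - xiD β c))) :=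
        (LipschitzWith.of_dist_le_mul (K := 1) fun y y' => by
          simpa [Real.dist_eq] using hlip y y').continuous
      refine nG_int_lin hc.measurable
        (C := |∫ y₂, φ b (z + k * (A1 + A2) + (0 + y₂)) ∂(nG (xiD β b - xiD β c))|) fun y => ?_
      have := hlip y 0
      have h4 := abs_sub_abs_le_abs_sub (∫ y₂, φ b (z + k * (A1 + A2) + (y + y₂)) ∂(nG (xiD β b - xiD β c)))
        (∫ y₂, φ b (z + k * (A1 + A2) + (0 + y₂)) ∂(nG (xiD β b - xiD β c)))
      rw [sub_zero] at this
      linarith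
    have h5 := integral_mono iG iF k1
    rw [integral_add (hf1.int _ _) (integrable_const _)] at h5
    simp at h5
    norm_num at h3
    linarith

lemma atom_cont (hβ : ValidBeta β) (hν : MemM ν) (hS : ν ((S : Set ℝ))ᶜ = 0) (hφ : IsAtomicSol β ν φ)
    (x : ℝ) : ContinuousOn (fun r => φ r x) (Icc 0 1) := by
  have hT : ∀ a ∈ Icc (0:ℝ) 1, ∀ b ∈ Icc (0:ℝ) 1, xiD β b - xiD β a ≤ xiD β 1 := fun a ha b hb => by
    have := xiD_mono hβ hb (right_mem_Icc.2 zero_le_one) hb.2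
    have := xiD_nonneg hβ ha
    linarith
  set K0 := ∫ z, |z| * Real.exp (Real.sqrt (xiD β 1) * |z|) ∂(nG 1) with hK0
  have hK0' : 0 ≤ K0 := integral_nonneg fun z => by positivity
  refine atom_ind hS (Q := fun a => ContinuousOn (fun r => φ r x) (Icc a 1)) ?_ ?_ 0 (by simp)
  · simp
  intro a ha ha1 ih
  have hn1 := nextPt_le_one hS a
  have hlt := lt_nextPt hS ha1
  have h0 : ∀ r r', r ∈ Icc a (nextPt ν a) → r' ∈ Icc a (nextPt ν a) → r < r' →
      |φ r' x - φ r x| ≤ K0 * √|xiD β r' - xiD β r| := by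
    intro r r' hr hr' hrr
    have hrI : r ∈ Icc (0:ℝ) 1 := ⟨by linarith [hr.1], by linarith [hr.2]⟩
    have hbI : r' ∈ Icc (0:ℝ) 1 := ⟨by linarith [hr'.1], by linarith [hr'.2]⟩
    obtain ⟨g1, hg1⟩ := (atom_reg hβ hν hS hφ _ hbI).c1q
    have hp := sub_nonneg.2 (xiD_mono hβ hrI hbI hrr.le)
    have h1 := gOp_near hg1 (distF_nonneg ν r) (distF_le_one hν r) hp x
    rw [← atom_step hβ hν hS hφ hrI.1 hrr
      (by rw [nextPt_eq hS hr.1 (by linarith [hr'.2])]; exact hr'.2)] at h1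
    rw [abs_sub_comm, abs_of_nonneg hp]
    exact h1.trans (wG_le hp (hT r hrI r' hbI))
  have h1 : ∀ r r', r ∈ Icc a (nextPt ν a) → r' ∈ Icc a (nextPt ν a) →
      |φ r' x - φ r x| ≤ K0 * √|xiD β r' - xiD β r| := by
    intro r r' hr hr'
    rcases lt_trichotomy r r' with h | rfl | h
    · exact h0 r r' hr hr' h
    · simp
    · rw [abs_sub_comm, abs_sub_comm (xiD β r')]
      exact h0 r' r hr' hr h
  have h2 : ContinuousOn (fun r => φ r x) (Icc a (nextPt ν a)) := by
    intro r hr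
    have hxi : ContinuousOn (xiD β) (Icc a (nextPt ν a)) :=
      (xiD_continuousOn hβ).mono (Icc_subset_Icc ha hn1)
    have hlim : Tendsto (fun r' => K0 * √|xiD β r' - xiD β r|) (nhdsWithin r (Icc a (nextPt ν a))) (nhds 0) := by
      have : ContinuousWithinAt (fun r' => K0 * √|xiD β r' - xiD β r|) (Icc a (nextPt ν a)) r :=
        continuousWithinAt_const.mul (((hxi r hr).sub continuousWithinAt_const).abs.sqrt)
      simpa [ContinuousWithinAt] using this
    rw [ContinuousWithinAt, tendsto_iff_dist_tendsto_zero]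
    refine squeeze_zero' (.of_forall fun _ => dist_nonneg) ?_ hlim
    filter_upwards [self_mem_nhdsWithin] with r' hr'
    exact h1 r r' hr hr'
  have := h2.union_of_isClosed ih isClosed_Icc isClosed_Icc
  rwa [Icc_union_Icc_eq_Icc hlt.le hn1] at this
end atomic2


lemma approx_meas {μ : Measure ℝ} (hμ : MemM μ) {δ : ℝ} (hδ : 0 < δ) :
    ∃ ν, MemM ν ∧ FinSupp ν ∧ dM μ ν < δ := by
  have := hμ.1
  obtain ⟨n, hn⟩ := exists_nat_one_div_lt hδ
  set N : ℝ := (n : ℝ) + 1 with hN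
  have hN0 : 0 < N := by positivity
  set f : ℝ → ℝ := fun x => (⌈N * x⌉ : ℝ) / N with hf
  have hfm : Measurable f := by fun_prop
  have hf1 : ∀ x, x ≤ f x := fun x => by
    simp only [hf]; rw [le_div_iff₀ hN0, mul_comm]; exact Int.le_ceil _
  have hf2 : ∀ x, f x ≤ x + 1 / N := fun x => by
    simp only [hf]; rw [div_le_iff₀ hN0]
    have : (x + 1 / N) * N = N * x + 1 := by field_simp
    rw [this]
    exact (Int.ceil_lt_add_one (N * x)).le
  have hf3 : ∀ x ∈ Icc (0:ℝ) 1, ∃ k ∈ Finset.range (n + 2), f x = (k : ℝ) / N := fun x hx => by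
    have h0 : 0 ≤ ⌈N * x⌉ := Int.ceil_nonneg (mul_nonneg hN0.le hx.1)
    obtain ⟨k, hk⟩ := Int.eq_ofNat_of_zero_le h0
    refine ⟨k, ?_, by simp [hf, hk]⟩
    have h1 : ⌈N * x⌉ ≤ (n + 1 : ℤ) := Int.ceil_le.2 (by push_cast; nlinarith [hx.2])
    simp; omega
  have hf4 : ∀ x ∈ Icc (0:ℝ) 1, f x ∈ Icc (0:ℝ) 1 := fun x hx => by
    obtain ⟨k, hk, e⟩ := hf3 x hx
    rw [e]
    have : (k : ℝ) ≤ N := by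
      have : k ≤ n + 1 := by simp at hk; omega
      rw [hN]; exact_mod_cast this
    exact ⟨by positivity, by rw [div_le_one hN0]; exact this⟩
  refine ⟨μ.map f, ⟨Measure.isProbabilityMeasure_map hfm.aemeasurable, ?_⟩,
    ⟨(Finset.range (n+2)).image (fun k : ℕ => (k : ℝ) / N), ?_⟩, ?_⟩
  · rw [Measure.map_apply hfm measurableSet_Icc.compl]
    refine measure_mono_null ?_ hμ.2
    intro x hx hx'
    exact hx (hf4 x hx')
  · rw [Measure.map_apply hfm (Finset.measurableSet _).compl]
    refine measure_mono_null ?_ hμ.2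
    intro x hx hx'
    apply hx
    obtain ⟨k, hk, e⟩ := hf3 x hx'
    rw [e]
    simp only [Finset.coe_image]
    exact ⟨k, hk, rfl⟩
  · have b1 : ∀ s, distF (μ.map f) s ≤ distF μ s := fun s => by
      refine ENNReal.toReal_mono (measure_ne_top _ _) ?_
      rw [Measure.map_apply hfm measurableSet_Icc]
      refine (measure_mono (t := Icc 0 s ∪ (Icc 0 1)ᶜ) ?_).trans
        ((measure_union_le _ _).trans (by rw [hμ.2, add_zero]))
      intro x hx
      by_cases h : x ∈ Icc (0:ℝ) 1
      · left; exact ⟨h.1, (hf1 x).trans hx.2⟩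
      · right; exact h
    have b2 : ∀ s, distF μ (s - 1 / N) ≤ distF (μ.map f) s := fun s => by
      have : IsProbabilityMeasure (μ.map f) := Measure.isProbabilityMeasure_map hfm.aemeasurable
      refine ENNReal.toReal_mono (measure_ne_top _ _) ?_
      rw [Measure.map_apply hfm measurableSet_Icc]
      refine measure_mono fun x hx => ⟨hx.1.trans (hf1 x), ?_⟩
      linarith [hf2 x, hx.2]
    have hInt : ∀ a b, IntervalIntegrable (distF μ) volume a b := fun a b =>
      (distF_mono hμ).intervalIntegrable
    have hmono := distF_mono hμ
    have hmono2 : Monotone (fun s => distF μ (s - 1 / N)) := fun a b h => hmono (by linarith)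
    have e1 : dM μ (μ.map f) ≤ ∫ s in (0:ℝ)..1, (distF μ s - distF μ (s - 1 / N)) := by
      have hm3 : Monotone (distF (μ.map f)) := fun a b h => by
        have : IsProbabilityMeasure (μ.map f) := Measure.isProbabilityMeasure_map hfm.aemeasurable
        exact ENNReal.toReal_mono (measure_ne_top _ _) (measure_mono (Icc_subset_Icc_right h))
      refine intervalIntegral.integral_mono_on zero_le_one
        ((hInt 0 1).sub hm3.intervalIntegrable).abs
        ((hInt 0 1).sub hmono2.intervalIntegrable) fun s _ => ?_
      rw [abs_of_nonneg (by linarith [b1 s])]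
      linarith [b2 s]
    have e2 : ∫ s in (0:ℝ)..1, (distF μ s - distF μ (s - 1 / N)) ≤ 1 / N := by
      rw [intervalIntegral.integral_sub (hInt 0 1) hmono2.intervalIntegrable,
        intervalIntegral.integral_comp_sub_right (distF μ)]
      have j1 := intervalIntegral.integral_add_adjacent_intervals (hInt 0 (1 - 1/N)) (hInt (1 - 1/N) 1)
      have j2 := intervalIntegral.integral_add_adjacent_intervals (hInt (0 - 1/N) 0) (hInt 0 (1 - 1/N))
      have j3 : 0 ≤ ∫ s in (0 - 1/N)..0, distF μ s := intervalIntegral.integral_nonneg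
        (by have : 0 < 1 / N := by positivity
            linarith) fun _ _ => distF_nonneg _ _
      have j4 : ∫ s in (1 - 1/N)..1, distF μ s ≤ ∫ s in (1 - 1/N)..1, (1:ℝ) :=
        intervalIntegral.integral_mono_on (by have : 0 < 1 / N := by positivity
                                              linarith) (hInt _ _) (by simp) fun s _ => distF_le_one hμ s
      simp only [intervalIntegral.integral_const, smul_eq_mul] at j4
      linarith
    linarith

lemma c1q_lim {F : ℕ → ℝ → ℝ} {f : ℝ → ℝ} (hF : ∀ n, ∃ g, C1Q (F n) g)
    (hl : ∀ x, Tendsto (fun n => F n x) atTop (nhds (f x))) : C1Q f (deriv f) := by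
  choose G hG using hF
  have key : ∀ x, ∃ l, Tendsto (fun n => G n x) (hyperfilter ℕ) (nhds l) := fun x => by
    obtain ⟨l, -, hl⟩ := (isCompact_Icc (a := (-1:ℝ)) (b := 1)).ultrafilter_le_nhds
      ((hyperfilter ℕ).map (fun n => G n x)) (by
        rw [le_principal_iff]
        exact Filter.Eventually.of_forall (f := (hyperfilter ℕ : Filter ℕ)) fun n => abs_le.1 ((hG n).2.1 x))
    exact ⟨l, hl⟩
  choose g hg using key
  have hl' : ∀ x, Tendsto (fun n => F n x) (hyperfilter ℕ) (nhds (f x)) := fun x =>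
    (hl x).mono_left Nat.hyperfilter_le_atTop
  have hC : C1Q f g := by
    refine ⟨fun x h => ?_, fun x => ?_, fun x y => ?_⟩
    · exact le_of_tendsto (((hl' (x + h)).sub (hl' x)).sub ((hg x).mul_const h)).abs
        (.of_forall fun n => (hG n).1 x h)
    · exact le_of_tendsto (hg x).abs (.of_forall fun n => (hG n).2.1 x)
    · exact le_of_tendsto ((hg x).sub (hg y)).abs (.of_forall fun n => (hG n).2.2 x y)
  have : deriv f = g := funext fun x => (hC.hasDerivAt x).deriv
  rwa [this]

section limit
variable {β : ℕ → ℝ} {Φ : Measure ℝ → ℝ → ℝ → ℝ} {μ : Measure ℝ}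

lemma phi_approx (hΦ : IsParisiFamily β Φ) (hμ : MemM μ)
    {ε : ℝ} (hε : 0 < ε) : ∃ ν S, MemM ν ∧ ν ((S : Finset ℝ) : Set ℝ)ᶜ = 0 ∧
    IsAtomicSol β ν (Φ ν) ∧ dM μ ν < ε ∧ ∀ s ∈ Icc (0:ℝ) 1, ∀ x, |Φ μ s x - Φ ν s x| < ε := by
  obtain ⟨δ, hδ, h⟩ := hΦ.2 μ hμ ε hε
  obtain ⟨ν, h1, ⟨S, h2⟩, h3⟩ := approx_meas hμ (lt_min hδ hε)
  exact ⟨ν, S, h1, h2, hΦ.1 ν h1 ⟨S, h2⟩, h3.trans_le (min_le_right _ _),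
    h ν h1 (h3.trans_le (min_le_left _ _))⟩

lemma phi_c1q (hβ : ValidBeta β) (hΦ : IsParisiFamily β Φ) (hμ : MemM μ)
    {r : ℝ} (hr : r ∈ Icc (0:ℝ) 1) : C1Q (Φ μ r) (deriv (Φ μ r)) := by
  choose ν S h1 h2 h3 h4 h5 using fun n : ℕ => phi_approx hΦ hμ (Nat.one_div_pos_of_nat (α := ℝ) (n := n))
  refine c1q_lim (F := fun n => Φ (ν n) r) (fun n => (atom_reg hβ (h1 n) (h2 n) (h3 n) r hr).c1q) fun x => ?_
  rw [tendsto_iff_dist_tendsto_zero]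
  refine squeeze_zero (fun _ => dist_nonneg) (fun n => ?_) tendsto_one_div_add_atTop_nhds_zero_nat
  rw [dist_comm]
  exact (h5 n r hr x).le

lemma phi_cont (hβ : ValidBeta β) (hΦ : IsParisiFamily β Φ) (hμ : MemM μ)
    (x : ℝ) : ContinuousOn (fun r => Φ μ r x) (Icc 0 1) := by
  refine continuousOn_of_uniform_approx_of_continuousOn fun U hU => ?_
  obtain ⟨ε, hε, hU⟩ := Metric.mem_uniformity_dist.1 hU
  obtain ⟨ν, S, h1, h2, h3, h4, h5⟩ := phi_approx hΦ hμ hε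
  exact ⟨fun r => Φ ν r x, atom_cont hβ h1 h2 h3 x, fun r hr => hU (h5 r hr x)⟩

lemma dphi_cont1 (hβ : ValidBeta β) (hΦ : IsParisiFamily β Φ) (hμ : MemM μ)
    (x : ℝ) : ContinuousOn (fun r => deriv (Φ μ r) x) (Icc 0 1) := by
  refine continuousOn_of_uniform_approx_of_continuousOn fun U hU => ?_
  obtain ⟨ε, hε, hU⟩ := Metric.mem_uniformity_dist.1 hU
  refine ⟨fun r => (Φ μ r (x + ε / 2) - Φ μ r x) / (ε / 2), ?_, fun r hr => hU ?_⟩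
  · exact ((phi_cont hβ hΦ hμ _).sub (phi_cont hβ hΦ hμ _)).div_const _
  · have h := (phi_c1q hβ hΦ hμ hr).1 x (ε / 2)
    have h2 : 0 < ε / 2 := by linarith
    rw [Real.dist_eq]
    have e : deriv (Φ μ r) x - (Φ μ r (x + ε / 2) - Φ μ r x) / (ε / 2) =
      -((Φ μ r (x + ε / 2) - Φ μ r x - deriv (Φ μ r) x * (ε / 2)) / (ε / 2)) := by
      field_simp; ring
    rw [e, abs_neg, abs_div, abs_of_pos h2, div_lt_iff₀ h2]
    nlinarith

lemma dphi_cont (hβ : ValidBeta β) (hΦ : IsParisiFamily β Φ) (hμ : MemM μ)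
    : ContinuousOn (fun p : ℝ × ℝ => deriv (Φ μ p.1) p.2) (Icc 0 1 ×ˢ univ) := by
  refine continuousOn_prod_of_continuousOn_lipschitzOnWith' (fun p : ℝ × ℝ => deriv (Φ μ p.1) p.2) 1 ?_ ?_
  · intro r hr
    refine LipschitzOnWith.of_dist_le_mul fun x _ y _ => ?_
    simpa [Real.dist_eq] using (phi_c1q hβ hΦ hμ hr).2.2 x y
  · intro x _
    exact dphi_cont1 hβ hΦ hμ x

lemma phi_jcont (hβ : ValidBeta β) (hΦ : IsParisiFamily β Φ) (hμ : MemM μ)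
    : ContinuousOn (fun p : ℝ × ℝ => Φ μ p.1 p.2) (Icc 0 1 ×ˢ univ) := by
  refine continuousOn_prod_of_continuousOn_lipschitzOnWith' (fun p : ℝ × ℝ => Φ μ p.1 p.2) 1 ?_ ?_
  · intro r hr
    refine LipschitzOnWith.of_dist_le_mul fun x _ y _ => ?_
    simpa [Real.dist_eq] using (phi_c1q hβ hΦ hμ hr).lip x y
  · intro x _
    exact phi_cont hβ hΦ hμ x

lemma phi_ineq (hβ : ValidBeta β) (hΦ : IsParisiFamily β Φ) (hμ : MemM μ)
    {a b : ℝ} (ha : 0 ≤ a) (hab : a < b) (hb : b ≤ 1) (z c : ℝ) :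
    ∫ y, Φ μ b (z + c * (∫ r in a..b, distF μ r * zetaFn β r) + y) ∂(nG (xiD β b - xiD β a))
      - 1 / 2 * c ^ 2 * (∫ r in a..b, distF μ r * zetaFn β r) ≤ Φ μ a z := by
  have haI : a ∈ Icc (0:ℝ) 1 := ⟨by linarith, by linarith⟩
  have hbI : b ∈ Icc (0:ℝ) 1 := ⟨by linarith, by linarith⟩
  have h1I : (1:ℝ) ∈ Icc (0:ℝ) 1 := by simp
  set Z := zetaFn β 1
  have hZ : 0 ≤ Z := zeta_nonneg β h1I
  set A := ∫ r in a..b, distF μ r * zetaFn β r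
  set K := 2 + |c| * Z + 1 / 2 * c ^ 2 * Z
  have hK : 0 < K := by positivity
  refine le_of_forall_pos_le_add fun η hη => ?_
  obtain ⟨ν, S, h1, h2, h3, h4, h5⟩ := phi_approx hΦ hμ (div_pos hη hK)
  set ε := η / K
  have hKe : K * ε = η := mul_div_cancel₀ _ hK.ne'
  have key := atom_ineq hβ h1 h2 h3 ha hab hb z c
  set A' := ∫ r in a..b, distF ν r * zetaFn β r
  have hA : |A - A'| ≤ Z * ε := by
    have e : A - A' = ∫ r in a..b, (distF μ r - distF ν r) * zetaFn β r := by
      rw [← intervalIntegral.integral_sub (w_int hβ hμ haI hbI) (w_int hβ h1 haI hbI)]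
      simp only [sub_mul]
    have hi : ∀ p q, IntervalIntegrable (fun r => |distF μ r - distF ν r|) volume p q := fun p q =>
      ((distF_mono hμ).intervalIntegrable.sub (distF_mono h1).intervalIntegrable).abs
    have e2 : |∫ r in a..b, (distF μ r - distF ν r) * zetaFn β r| ≤
        ∫ r in a..b, Z * |distF μ r - distF ν r| := by
      refine intervalIntegral.abs_integral_le_integral_abs hab.le |>.trans ?_
      refine intervalIntegral.integral_mono_on hab.le ?_ ((hi a b).const_mul Z) fun r hr => ?_
      · simp only [sub_mul]
        exact ((w_int hβ hμ haI hbI).sub (w_int hβ h1 haI hbI)).abs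
      · have hrI : r ∈ Icc (0:ℝ) 1 := ⟨by linarith [hr.1], by linarith [hr.2]⟩
        rw [abs_mul, mul_comm, abs_of_nonneg (zeta_nonneg β hrI)]
        exact mul_le_mul_of_nonneg_right (zeta_mono hβ hrI h1I hrI.2) (abs_nonneg _)
    rw [e]
    refine e2.trans ?_
    rw [intervalIntegral.integral_const_mul]
    refine mul_le_mul_of_nonneg_left (le_trans ?_ h4.le) hZ
    exact intervalIntegral.integral_mono_interval ha hab.le hb (.of_forall fun r => abs_nonneg _) (hi 0 1)
  obtain ⟨g1, hg1⟩ := (atom_reg hβ h1 h2 h3 _ hbI).c1q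
  have hc := phi_c1q hβ hΦ hμ hbI
  have k1 : ∫ y, Φ μ b (z + c * A + y) ∂(nG (xiD β b - xiD β a)) ≤
      ∫ y, Φ ν b (z + c * A' + y) ∂(nG (xiD β b - xiD β a)) + (ε + |c| * (Z * ε)) := by
    have i2 : Integrable (fun y => Φ ν b (z + c * A' + y) + (ε + |c| * (Z * ε))) (nG (xiD β b - xiD β a)) :=
      (hg1.int _ _).add (integrable_const _)
    refine (integral_mono (hc.int _ _) i2 fun y => ?_).trans_eq ?_
    · have l1 := hc.lip (z + c * A + y) (z + c * A' + y)
      have l2 := h5 b hbI (z + c * A' + y)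
      have l3 : |z + c * A + y - (z + c * A' + y)| ≤ |c| * (Z * ε) := by
        have : z + c * A + y - (z + c * A' + y) = c * (A - A') := by ring
        rw [this, abs_mul]
        exact mul_le_mul_of_nonneg_left hA (abs_nonneg _)
      simp only
      linarith [(abs_le.1 (l1.trans l3)).2, (abs_lt.1 l2).2]
    · rw [integral_add (hg1.int _ _) (integrable_const _)]; simp
  have k2 := (abs_lt.1 (h5 a haI z)).1
  have k3 : 1 / 2 * c ^ 2 * A' ≤ 1 / 2 * c ^ 2 * A + 1 / 2 * c ^ 2 * (Z * ε) := by
    rw [← mul_add]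
    exact mul_le_mul_of_nonneg_left (by linarith [(abs_le.1 hA).1]) (by positivity)
  have : η = 2 * ε + |c| * (Z * ε) + 1 / 2 * c ^ 2 * (Z * ε) := by rw [← hKe]; simp only [K]; ring
  linarith
end limit


/-! ### stochastic part -/

lemma chain_le {F : ℝ → ℝ} {s t : ℝ} (hst : s ≤ t)
    (h : ∀ ε > 0, ∃ δ > 0, ∀ a b, s ≤ a → a ≤ b → b ≤ t → b - a ≤ δ → F b - F a ≤ ε * (b - a)) :
    F t ≤ F s := by
  have key : ∀ ε > 0, F t - F s ≤ ε * (t - s) := by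
    intro ε hε
    obtain ⟨δ, hδ, h⟩ := h ε hε
    obtain ⟨N, hN⟩ := exists_nat_gt ((t - s) / δ)
    have hd : 0 ≤ (t - s) / δ := div_nonneg (by linarith) hδ.le
    have hN0 : (0:ℝ) < N := by linarith
    set k := (t - s) / N with hk
    have hk0 : 0 ≤ k := div_nonneg (by linarith) hN0.le
    have hkδ : k ≤ δ := by
      rw [div_lt_iff₀ hδ] at hN
      rw [hk, div_le_iff₀ hN0]; linarith
    have hNk : (N : ℝ) * k = t - s := by rw [hk]; field_simp
    have ind : ∀ j : ℕ, j ≤ N → F (s + j * k) - F s ≤ ε * (j * k) := by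
      intro j
      induction j with
      | zero => intro _; simp
      | succ j ih =>
        intro hj
        have h1 := ih (by omega)
        have hj' : ((j:ℝ) + 1) ≤ N := by exact_mod_cast hj
        have h2 := h (s + j * k) (s + (j + 1) * k) (by have : 0 ≤ (j:ℝ) * k := by positivity
                                                       linarith) (by linarith)
          (by nlinarith) (by linarith)
        push_cast
        linarith
    have := ind N le_rfl
    rw [hNk] at this
    simpa using this
  by_contra hc
  push Not at hc
  have hst' : s < t := by
    rcases hst.eq_or_lt with rfl | h
    · exact absurd hc (lt_irrefl _)
    · exact h
  have h1 : 0 < t - s := by linarith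
  have := key ((F t - F s) / (2 * (t - s))) (by apply div_pos <;> linarith)
  have e : (F t - F s) / (2 * (t - s)) * (t - s) = (F t - F s) / 2 := by field_simp
  linarith

lemma meas_int {Ω : Type*} [MeasurableSpace Ω] {g : ℝ × Ω → ℝ} (hg : Measurable g) (a b : ℝ) :
    Measurable (fun ω => ∫ r in a..b, g (r, ω)) := by
  simp only [intervalIntegral]
  exact (hg.stronglyMeasurable.integral_prod_left').measurable.sub
    (hg.stronglyMeasurable.integral_prod_left').measurable

/-- bounded progressively measurable controls on `[s,t]` -/
structure Ctl {Ω : Type*} {mΩ : MeasurableSpace Ω} (𝓕 : Filtration ℝ mΩ) (s t C : ℝ)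
    (v : ℝ → Ω → ℝ) : Prop where
  meas : ∀ b ∈ Icc s t, @Measurable (ℝ × Ω) ℝ (@Prod.instMeasurableSpace ℝ Ω _ (𝓕 b)) _
    (fun p => v (max s (min p.1 b)) p.2)
  bd : ∀ r ∈ Icc s t, ∀ ω, |v r ω| ≤ C

section ctl
variable {Ω : Type*} {mΩ : MeasurableSpace Ω} {𝓕 : Filtration ℝ mΩ} {s t C C' : ℝ}
  {u v : ℝ → Ω → ℝ}

lemma clamp_mem {s b : ℝ} (h : s ≤ b) (r : ℝ) : max s (min r b) ∈ Icc s b :=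
  ⟨le_max_left _ _, max_le h (min_le_right _ _)⟩

lemma clamp_eq {s b r : ℝ} (hr : r ∈ Icc s b) : max s (min r b) = r := by
  rw [min_eq_left hr.2, max_eq_right hr.1]

lemma comp_meas {Ω : Type*} (m : MeasurableSpace Ω) {k : ℝ → ℝ → ℝ → ℝ}
    (hk : Measurable (fun q : ℝ × ℝ × ℝ => k q.1 q.2.1 q.2.2)) {c : ℝ → ℝ} (hc : Measurable c)
    {U V : ℝ × Ω → ℝ} (hU : Measurable U) (hV : Measurable V) :
    Measurable (fun p : ℝ × Ω => k (c p.1) (U p) (V p)) :=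
  hk.comp ((hc.comp measurable_fst).prodMk (hU.prodMk hV))

lemma Ctl.comp (hu : Ctl 𝓕 s t C u) (hv : Ctl 𝓕 s t C' v) {k : ℝ → ℝ → ℝ → ℝ}
    (hk : Measurable (fun q : ℝ × ℝ × ℝ => k q.1 q.2.1 q.2.2)) {M : ℝ}
    (hM : ∀ r ∈ Icc s t, ∀ x y, |x| ≤ C → |y| ≤ C' → |k r x y| ≤ M) :
    Ctl 𝓕 s t M (fun r ω => k r (u r ω) (v r ω)) where
  meas b hb := comp_meas (𝓕 b) hk (c := fun r => max s (min r b)) (by fun_prop)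
    (hu.meas b hb) (hv.meas b hb)
  bd r hr ω := hM r hr _ _ (hu.bd r hr ω) (hv.bd r hr ω)

lemma cont_meas {Ω : Type*} (m : MeasurableSpace Ω) {g : ℝ → Ω → ℝ} (h1 : ∀ ω, Continuous (fun r => g r ω))
    (h2 : ∀ r, Measurable (g r)) : Measurable (fun p : ℝ × Ω => g p.1 p.2) :=
  measurable_uncurry_of_continuous_of_measurable h1 h2

lemma Ctl.of_cont (hc : ∀ ω, ContinuousOn (fun r => v r ω) (Icc s t))
    (hm : ∀ r ∈ Icc s t, Measurable[𝓕 r] (v r)) (hb : ∀ r ∈ Icc s t, ∀ ω, |v r ω| ≤ C) :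
    Ctl 𝓕 s t C v where
  meas b hb := by
    refine cont_meas (𝓕 b) (g := fun r ω => v (max s (min r b)) ω) (fun ω => ?_) fun r => ?_
    · refine (hc ω).comp_continuous (by fun_prop) fun r => ?_
      exact Icc_subset_Icc_right hb.2 (clamp_mem hb.1 r)
    · have := clamp_mem hb.1 r
      exact (hm _ (Icc_subset_Icc_right hb.2 this)).mono (𝓕.mono this.2) le_rfl
  bd := hb

lemma Ctl.of_prog (hp : IsStronglyProgressive 𝓕 v)
    (hb : ∀ r ∈ Icc s t, ∀ ω, |v r ω| ≤ C) :
    Ctl 𝓕 s t C v where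
  meas b hb := by
    have := (hp b).measurable
    have h2 : @Measurable (ℝ × Ω) (Iic b × Ω) (@Prod.instMeasurableSpace ℝ Ω _ (𝓕 b))
      (@Prod.instMeasurableSpace (Iic b) Ω _ (𝓕 b)) (fun p => (⟨max s (min p.1 b), (clamp_mem hb.1 p.1).2⟩, p.2)) := by
      let _ := 𝓕 b
      apply Measurable.prodMk
      · apply Measurable.subtype_mk; fun_prop
      · exact measurable_snd
    exact this.comp h2
  bd := hb

lemma Ctl.meas' (hv : Ctl 𝓕 s t C v) {b : ℝ} (hb : b ∈ Icc s t) :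
    Measurable (fun p : ℝ × Ω => v (max s (min p.1 b)) p.2) :=
  (hv.meas b hb).mono (sup_le_sup le_rfl (MeasurableSpace.comap_mono (𝓕.le b))) le_rfl

lemma Ctl.adap (hv : Ctl 𝓕 s t C v) {b : ℝ} (hb : b ∈ Icc s t) : Measurable[𝓕 b] (v b) := by
  have := @Measurable.comp _ _ _ (𝓕 b) (@Prod.instMeasurableSpace ℝ Ω _ (𝓕 b)) _ _ (fun ω => (b, ω))
    (hv.meas b hb) (@measurable_prodMk_left _ _ _ (𝓕 b) b)
  simpa only [Function.comp_def, clamp_eq (right_mem_Icc.2 hb.1)] using this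

lemma Ctl.int_meas (hv : Ctl 𝓕 s t C v) {a b : ℝ} (ha : s ≤ a) (hab : a ≤ b) (hb : b ≤ t) :
    Measurable[𝓕 b] (fun ω => ∫ r in a..b, v r ω) := by
  have h := @meas_int Ω (𝓕 b) _ (hv.meas b ⟨by linarith, hb⟩) a b
  convert h using 2 with ω
  refine intervalIntegral.integral_congr fun r hr => ?_
  rw [uIcc_of_le hab] at hr
  simp only
  rw [clamp_eq ⟨by linarith [hr.1], hr.2⟩]

lemma Ctl.clamp_ii (hv : Ctl 𝓕 s t C v) (hst : s ≤ t) (ω : Ω) (a b : ℝ) :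
    IntervalIntegrable (fun r => v (max s (min r t)) ω) volume a b := by
  have hm : Measurable (fun r => v (max s (min r t)) ω) :=
    (hv.meas' (right_mem_Icc.2 hst)).comp measurable_prodMk_right
  refine (intervalIntegrable_const (c := C)).mono_fun hm.aestronglyMeasurable (.of_forall fun r => ?_)
  exact (hv.bd _ (clamp_mem hst r) ω).trans (le_abs_self _)

lemma Ctl.ii (hv : Ctl 𝓕 s t C v) {a b : ℝ} (ha : a ∈ Icc s t) (hb : b ∈ Icc s t) (ω : Ω) :
    IntervalIntegrable (fun r => v r ω) volume a b := by
  have hst : s ≤ t := ha.1.trans ha.2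
  refine (hv.clamp_ii hst ω a b).congr fun r hr => ?_
  have := uIcc_subset_Icc ha hb (uIoc_subset_uIcc hr)
  rw [clamp_eq this]

lemma Ctl.clamp_bd (hv : Ctl 𝓕 s t C v) (hst : s ≤ t) (ω : Ω) (a b : ℝ) :
    |∫ q in a..b, v (max s (min q t)) ω| ≤ C * |b - a| := by
  rw [← Real.norm_eq_abs]
  exact intervalIntegral.norm_integral_le_of_norm_le_const fun q _ => hv.bd _ (clamp_mem hst q) ω

lemma Ctl.int_bd (hv : Ctl 𝓕 s t C v) {a b : ℝ} (ha : s ≤ a) (hab : a ≤ b) (hb : b ≤ t) (ω : Ω) :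
    |∫ r in a..b, v r ω| ≤ C * (b - a) := by
  have := intervalIntegral.norm_integral_le_of_norm_le_const (f := fun r => v r ω) (a := a) (b := b) (C := C)
    fun r hr => by
      rw [uIoc_of_le hab] at hr
      exact hv.bd r ⟨by linarith [hr.1], by linarith [hr.2]⟩ ω
  rwa [abs_of_nonneg (by linarith : 0 ≤ b - a)] at this

lemma Ctl.int_integrable (hv : Ctl 𝓕 s t C v) {a b : ℝ} (ha : s ≤ a) (hab : a ≤ b) (hb : b ≤ t)
    (P : Measure Ω) [IsProbabilityMeasure P] : Integrable (fun ω => ∫ r in a..b, v r ω) P :=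
  Integrable.of_bound ((hv.int_meas ha hab hb).mono (𝓕.le b) le_rfl).aestronglyMeasurable
    (C * (b - a)) (.of_forall fun ω => hv.int_bd ha hab hb ω)

lemma Ctl.int_cont (hv : Ctl 𝓕 s t C v) (ω : Ω) :
    ContinuousOn (fun b => ∫ r in s..b, v r ω) (Icc s t) := by
  rcases le_or_gt s t with hst | hst
  · have := intervalIntegral.continuousOn_primitive_interval (a := s) (b := t) (μ := volume)
      (f := fun r => v r ω) (by
        have := hv.ii (left_mem_Icc.2 hst) (right_mem_Icc.2 hst) ω
        rwa [intervalIntegrable_iff', uIcc_of_le hst] at *)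
    rwa [uIcc_of_le hst] at this
  · simp [Icc_eq_empty (not_le.2 hst)]

/-- averaged control -/
def avg (s t : ℝ) (v : ℝ → Ω → ℝ) (n : ℕ) (r : ℝ) (ω : Ω) : ℝ :=
  ((n : ℝ) + 1) * ∫ q in (r - 1 / ((n : ℝ) + 1))..r, v (max s (min q t)) ω

lemma Ctl.avg_lip (hv : Ctl 𝓕 s t C v) (hst : s ≤ t) (n : ℕ) (ω : Ω) (r r' : ℝ) :
    |avg s t v n r ω - avg s t v n r' ω| ≤ (2 * C * ((n : ℝ) + 1)) * |r - r'| := by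
  have hb := hv.clamp_bd hst ω
  have hii := hv.clamp_ii hst ω
  unfold avg
  set d := 1 / ((n : ℝ) + 1)
  have e1 := intervalIntegral.integral_add_adjacent_intervals (hii (r - d) (r' - d)) (hii (r' - d) r')
  have e2 := intervalIntegral.integral_add_adjacent_intervals (hii (r - d) r') (hii r' r)
  have e3 : (∫ q in (r - d)..r, v (max s (min q t)) ω) - ∫ q in (r' - d)..r', v (max s (min q t)) ω =
    (∫ q in (r - d)..(r' - d), v (max s (min q t)) ω) + ∫ q in r'..r, v (max s (min q t)) ω := by linarith
  rw [← mul_sub, e3, abs_mul, abs_of_nonneg (by positivity : (0:ℝ) ≤ n + 1)]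
  have h1 := hb (r - d) (r' - d)
  have h2 := hb r' r
  have h3 : |r' - d - (r - d)| = |r - r'| := by rw [abs_sub_comm]; congr 1; ring
  rw [h3] at h1
  have h4 := (abs_add_le (∫ q in (r - d)..(r' - d), v (max s (min q t)) ω)
    (∫ q in r'..r, v (max s (min q t)) ω)).trans (add_le_add h1 h2)
  have h5 := mul_le_mul_of_nonneg_left h4 (by positivity : (0:ℝ) ≤ n + 1)
  refine h5.trans_eq ?_
  ring

lemma Ctl.avg (hv : Ctl 𝓕 s t C v) (hst : s ≤ t) (n : ℕ) : Ctl 𝓕 s t C (avg s t v n) := by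
  refine Ctl.of_cont (fun ω => Continuous.continuousOn ?_) (fun r hr => ?_) fun r hr ω => ?_
  · have hC : 0 ≤ C := (abs_nonneg _).trans (hv.bd s (left_mem_Icc.2 hst) ω)
    refine (LipschitzWith.of_dist_le_mul (K := ⟨2 * C * ((n : ℝ) + 1), by positivity⟩) fun a b => ?_).continuous
    exact hv.avg_lip hst n ω a b
  · have h := @meas_int Ω (𝓕 r) _ (hv.meas r hr) (r - 1 / ((n : ℝ) + 1)) r
    have h2 := h.const_mul ((n : ℝ) + 1)
    convert h2 using 2 with ω
    unfold _root_.avg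
    congr 1
    refine intervalIntegral.integral_congr fun q hq => ?_
    rw [uIcc_of_le (by have : 0 < 1 / ((n : ℝ) + 1) := by positivity
                       linarith)] at hq
    rw [min_eq_left (hq.2.trans hr.2), min_eq_left hq.2]
  · unfold _root_.avg
    have : |∫ q in (r - 1 / ((n : ℝ) + 1))..r, v (max s (min q t)) ω| ≤ C * |r - (r - 1 / ((n : ℝ) + 1))| :=
      hv.clamp_bd hst ω _ _
    rw [sub_sub_cancel, abs_of_pos (by positivity : 0 < 1 / ((n : ℝ) + 1))] at this
    rw [abs_mul, abs_of_nonneg (by positivity : (0:ℝ) ≤ n + 1)]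
    calc ((n : ℝ) + 1) * _ ≤ ((n : ℝ) + 1) * (C * (1 / ((n : ℝ) + 1))) :=
          mul_le_mul_of_nonneg_left this (by positivity)
      _ = C := by field_simp

lemma Ctl.avg_tendsto (hv : Ctl 𝓕 s t C v) (hst : s ≤ t) (ω : Ω) :
    ∀ᵐ r, r ∈ Icc s t → Tendsto (fun n => _root_.avg s t v n r ω) atTop (nhds (v r ω)) := by
  have hloc : LocallyIntegrable (fun r => v (max s (min r t)) ω) volume := by
    have hm : Measurable (fun r => v (max s (min r t)) ω) :=
      (hv.meas' (right_mem_Icc.2 hst)).comp measurable_prodMk_right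
    refine (MeasureTheory.locallyIntegrable_const C).mono hm.aestronglyMeasurable (.of_forall fun r => ?_)
    exact (hv.bd _ (clamp_mem hst r) ω).trans (le_abs_self _)
  filter_upwards [LocallyIntegrable.ae_hasDerivAt_integral hloc] with r hr hrI
  have h := hr s
  rw [clamp_eq hrI] at h
  have h2 := h.tendsto_slope_zero
  have h3 : Tendsto (fun n : ℕ => -(1 / ((n:ℝ) + 1))) atTop (nhdsWithin 0 {0}ᶜ) := by
    rw [tendsto_nhdsWithin_iff]
    refine ⟨by simpa using (tendsto_one_div_add_atTop_nhds_zero_nat (𝕜 := ℝ)).neg, .of_forall fun n => ?_⟩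
    have : (0:ℝ) < 1 / (n + 1) := by positivity
    simp only [mem_compl_iff, mem_singleton_iff]; linarith
  refine (h2.comp h3).congr fun n => ?_
  have hii := hv.clamp_ii hst ω
  simp only [Function.comp, _root_.avg, smul_eq_mul]
  have e1 := intervalIntegral.integral_add_adjacent_intervals (hii s (r - 1 / ((n:ℝ)+1))) (hii (r - 1 / ((n:ℝ)+1)) r)
  rw [← e1, ← sub_eq_add_neg, inv_neg, one_div, inv_inv]
  ring

lemma Ctl.avg_L1 (hv : Ctl 𝓕 s t C v) (hst : s ≤ t) (P : Measure Ω) [IsProbabilityMeasure P] :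
    Tendsto (fun n => ∫ ω, (∫ r in s..t, |_root_.avg s t v n r ω - v r ω|) ∂P) atTop (nhds 0) := by
  have hc : ∀ n, Ctl 𝓕 s t (2 * C) (fun r ω => |_root_.avg s t v n r ω - v r ω|) := fun n =>
    (hv.avg hst n).comp hv (k := fun _ x y => |x - y|) (by fun_prop) fun r hr x y hx hy => by
      rw [abs_abs]; linarith [abs_sub x y]
  have h1 : ∀ ω, Tendsto (fun n => ∫ r in s..t, |_root_.avg s t v n r ω - v r ω|) atTop (nhds 0) := fun ω => by
    have : Tendsto (fun n => ∫ r in s..t, |_root_.avg s t v n r ω - v r ω|) atTop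
        (nhds (∫ r in s..t, (0:ℝ))) := by
      refine intervalIntegral.tendsto_integral_filter_of_dominated_convergence (fun _ => 2 * C)
        (.of_forall fun n => ?_) (.of_forall fun n => .of_forall fun r hr => ?_) (by simp) ?_
      · have := (hc n).ii (left_mem_Icc.2 hst) (right_mem_Icc.2 hst) ω
        exact (intervalIntegrable_iff.1 this).aestronglyMeasurable
      · rw [uIoc_of_le hst] at hr
        exact (hc n).bd r ⟨hr.1.le, hr.2⟩ ω
      · filter_upwards [hv.avg_tendsto hst ω] with r hr hr'
        rw [uIoc_of_le hst] at hr'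
        have := ((hr ⟨hr'.1.le, hr'.2⟩).sub_const (v r ω)).abs
        simpa using this
    simpa using this
  have h2 := tendsto_integral_of_dominated_convergence (μ := P)
    (F := fun n ω => ∫ r in s..t, |_root_.avg s t v n r ω - v r ω|) (f := fun _ => (0:ℝ))
    (fun _ => 2 * C * (t - s)) (fun n => ((hc n).int_integrable le_rfl hst le_rfl P).aestronglyMeasurable)
    (integrable_const _) (fun n => .of_forall fun ω => (hc n).int_bd le_rfl hst le_rfl ω)
    (.of_forall h1)
  simpa using h2
end ctl


/-- abstract setting for the stochastic argument -/
structure SCtx {Ω : Type*} {mΩ : MeasurableSpace Ω} (P : Measure Ω) (𝓕 : Filtration ℝ mΩ)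
    (w : ℝ → ℝ) (f f1 : ℝ → ℝ → ℝ) (W : ℝ → Ω → ℝ) (s t K : ℝ) : Prop where
  st : s < t
  wm : Measurable w
  w0 : ∀ r, 0 ≤ w r
  wK : ∀ r, w r ≤ K
  fC : ∀ r ∈ Icc s t, C1Q (f r) (f1 r)
  f1c : ContinuousOn (fun p : ℝ × ℝ => f1 p.1 p.2) (Icc s t ×ˢ univ)
  Wad : ∀ r ∈ Icc s t, Measurable[𝓕 r] (W r)
  Wi : ∀ r ∈ Icc s t, Integrable (W r) P
  Wc : ∀ ω, ContinuousOn (fun r => W r ω) (Icc s t)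
  Ws : ∀ ω, W s ω = 0
  step : ∀ a b, s ≤ a → a < b → b ≤ t → ∀ (Z c : Ω → ℝ) (C : ℝ), Measurable[𝓕 a] Z → Integrable Z P →
    Measurable[𝓕 a] c → (∀ ω, |c ω| ≤ C) →
    ∫ ω, (f b (Z ω + c ω * (∫ r in a..b, w r) + (W b ω - W a ω))
      - 1 / 2 * c ω ^ 2 * (∫ r in a..b, w r)) ∂P ≤ ∫ ω, f a (Z ω) ∂P

/-- controlled process -/
def Yp {Ω : Type*} (w : ℝ → ℝ) (W : ℝ → Ω → ℝ) (s x : ℝ) (v : ℝ → Ω → ℝ) (r : ℝ) (ω : Ω) : ℝ :=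
  x + (∫ q in s..r, w q * v q ω) + W r ω

/-- running cost -/
def Jf {Ω : Type*} [MeasurableSpace Ω] (P : Measure Ω) (w : ℝ → ℝ) (f : ℝ → ℝ → ℝ) (W : ℝ → Ω → ℝ)
    (s x : ℝ) (v : ℝ → Ω → ℝ) (r : ℝ) : ℝ :=
  ∫ ω, (f r (Yp w W s x v r ω) - 1 / 2 * ∫ q in s..r, w q * (v q ω) ^ 2) ∂P

section core
variable {Ω : Type*} {mΩ : MeasurableSpace Ω} {P : Measure Ω} [IsProbabilityMeasure P]
  {𝓕 : Filtration ℝ mΩ} {w : ℝ → ℝ} {f f1 : ℝ → ℝ → ℝ} {W : ℝ → Ω → ℝ} {s t K C C' : ℝ}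
  {v v' : ℝ → Ω → ℝ}

lemma SCtx.K0 (h : SCtx P 𝓕 w f f1 W s t K) : 0 ≤ K := (h.w0 0).trans (h.wK 0)

lemma SCtx.wabs (h : SCtx P 𝓕 w f f1 W s t K) (r : ℝ) : |w r| ≤ K := by
  rw [abs_of_nonneg (h.w0 r)]; exact h.wK r

lemma SCtx.wv (h : SCtx P 𝓕 w f f1 W s t K) (hv : Ctl 𝓕 s t C v) :
    Ctl 𝓕 s t (K * C) (fun r ω => w r * v r ω) := by
  have := h.wm
  refine hv.comp hv (k := fun r x _ => w r * x) (by fun_prop) fun r hr x y hx _ => ?_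
  rw [abs_mul]
  exact mul_le_mul (h.wabs r) hx (abs_nonneg _) h.K0

lemma SCtx.wv2 (h : SCtx P 𝓕 w f f1 W s t K) (hv : Ctl 𝓕 s t C v) :
    Ctl 𝓕 s t (K * C ^ 2) (fun r ω => w r * v r ω ^ 2) := by
  have := h.wm
  refine hv.comp hv (k := fun r x _ => w r * x ^ 2) (by fun_prop) fun r hr x y hx _ => ?_
  rw [abs_mul, abs_pow]
  exact mul_le_mul (h.wabs r) (pow_le_pow_left₀ (abs_nonneg _) hx 2) (by positivity) h.K0

lemma SCtx.wi (h : SCtx P 𝓕 w f f1 W s t K) (a b : ℝ) : IntervalIntegrable w volume a b :=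
  (intervalIntegrable_const (c := K)).mono_fun h.wm.aestronglyMeasurable
    (.of_forall fun r => (h.wabs r).trans (le_abs_self _))

lemma SCtx.Y_meas (h : SCtx P 𝓕 w f f1 W s t K) (hv : Ctl 𝓕 s t C v) (x : ℝ) {r : ℝ}
    (hr : r ∈ Icc s t) : Measurable[𝓕 r] (Yp w W s x v r) :=
  (((h.wv hv).int_meas le_rfl hr.1 hr.2).const_add x).add (h.Wad r hr)

lemma SCtx.Y_int (h : SCtx P 𝓕 w f f1 W s t K) (hv : Ctl 𝓕 s t C v) (x : ℝ) {r : ℝ}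
    (hr : r ∈ Icc s t) : Integrable (Yp w W s x v r) P :=
  ((integrable_const x).add ((h.wv hv).int_integrable le_rfl hr.1 hr.2 P)).add (h.Wi r hr)

lemma SCtx.Y_cont (h : SCtx P 𝓕 w f f1 W s t K) (hv : Ctl 𝓕 s t C v) (x : ℝ) (ω : Ω) :
    ContinuousOn (fun r => Yp w W s x v r ω) (Icc s t) :=
  (continuousOn_const.add ((h.wv hv).int_cont ω)).add (h.Wc ω)

lemma SCtx.f_int (h : SCtx P 𝓕 w f f1 W s t K) {r : ℝ} (hr : r ∈ Icc s t) {Z : Ω → ℝ}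
    (hZ : Integrable Z P) : Integrable (fun ω => f r (Z ω)) P := by
  refine ((integrable_const |f r 0|).add hZ.abs).mono'
    ((h.fC r hr).cont.comp_aestronglyMeasurable hZ.aestronglyMeasurable) (.of_forall fun ω => ?_)
  simpa using (h.fC r hr).growth 0 (Z ω)

lemma SCtx.fY_int (h : SCtx P 𝓕 w f f1 W s t K) (hv : Ctl 𝓕 s t C v) (x : ℝ) {r : ℝ}
    (hr : r ∈ Icc s t) : Integrable (fun ω => f r (Yp w W s x v r ω)) P :=
  h.f_int hr (h.Y_int hv x hr)

lemma SCtx.J_int (h : SCtx P 𝓕 w f f1 W s t K) (hv : Ctl 𝓕 s t C v) (x : ℝ) {r : ℝ}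
    (hr : r ∈ Icc s t) :
    Integrable (fun ω => f r (Yp w W s x v r ω) - 1 / 2 * ∫ q in s..r, w q * (v q ω) ^ 2) P :=
  (h.fY_int hv x hr).sub (((h.wv2 hv).int_integrable le_rfl hr.1 hr.2 P).const_mul _)

lemma SCtx.J_s (h : SCtx P 𝓕 w f f1 W s t K) (x : ℝ) (v : ℝ → Ω → ℝ) :
    Jf P w f W s x v s = f s x := by
  simp [Jf, Yp, h.Ws]

/-- Lipschitz controls: one step -/
lemma SCtx.J_step (h : SCtx P 𝓕 w f f1 W s t K) (hv : Ctl 𝓕 s t C v) (x : ℝ) {L : ℝ}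
    (hL : ∀ r ∈ Icc s t, ∀ r' ∈ Icc s t, ∀ ω, |v r ω - v r' ω| ≤ L * |r - r'|) {a b : ℝ}
    (ha : s ≤ a) (hab : a < b) (hb : b ≤ t) :
    Jf P w f W s x v b - Jf P w f W s x v a ≤ K * L * (1 + C) * (b - a) ^ 2 := by
  have haI : a ∈ Icc s t := ⟨ha, by linarith⟩
  have hbI : b ∈ Icc s t := ⟨by linarith, hb⟩
  have hsI : s ∈ Icc s t := ⟨le_rfl, h.st.le⟩
  have hK := h.K0
  have hst := h.step a b ha hab hb (Yp w W s x v a) (v a) C (h.Y_meas hv x haI) (h.Y_int hv x haI)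
    (hv.adap haI) (hv.bd a haI)
  set A := ∫ r in a..b, w r
  have ib : ∀ ω, f b (Yp w W s x v b ω) - 1 / 2 * ∫ q in s..b, w q * (v q ω) ^ 2 ≤
      (f b (Yp w W s x v a ω + v a ω * A + (W b ω - W a ω)) - 1 / 2 * v a ω ^ 2 * A)
      - (1 / 2 * ∫ q in s..a, w q * (v q ω) ^ 2) + K * L * (1 + C) * (b - a) ^ 2 := by
    intro ω
    have hC : 0 ≤ C := (abs_nonneg _).trans (hv.bd a haI ω)
    have e1 := intervalIntegral.integral_add_adjacent_intervals ((h.wv hv).ii hsI haI ω) ((h.wv hv).ii haI hbI ω)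
    have e2 := intervalIntegral.integral_add_adjacent_intervals ((h.wv2 hv).ii hsI haI ω) ((h.wv2 hv).ii haI hbI ω)
    have d1 : |(∫ q in a..b, w q * v q ω) - v a ω * A| ≤ K * L * (b - a) * |b - a| := by
      rw [← intervalIntegral.integral_const_mul, ← intervalIntegral.integral_sub ((h.wv hv).ii haI hbI ω)
        ((h.wi a b).const_mul _), ← Real.norm_eq_abs]
      refine intervalIntegral.norm_integral_le_of_norm_le_const fun q hq => ?_
      rw [uIoc_of_le hab.le] at hq
      have hqI : q ∈ Icc s t := ⟨by linarith [hq.1], by linarith [hq.2]⟩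
      have e : w q * v q ω - v a ω * w q = w q * (v q ω - v a ω) := by ring
      rw [e, Real.norm_eq_abs, abs_mul, mul_assoc]
      have hl := hL q hqI a haI ω
      have hL0 : 0 ≤ L := by
        by_contra hn
        have : 0 < |q - a| := abs_pos.2 (by linarith [hq.1])
        nlinarith [abs_nonneg (v q ω - v a ω)]
      refine mul_le_mul (h.wabs q) (hl.trans ?_) (abs_nonneg _) hK
      rw [abs_of_nonneg (by linarith [hq.1])]
      exact mul_le_mul_of_nonneg_left (by linarith [hq.2]) hL0
    have d2 : |(∫ q in a..b, w q * v q ω ^ 2) - v a ω ^ 2 * A| ≤ K * (L * (b - a) * (2 * C)) * |b - a| := by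
      rw [← intervalIntegral.integral_const_mul, ← intervalIntegral.integral_sub ((h.wv2 hv).ii haI hbI ω)
        ((h.wi a b).const_mul _), ← Real.norm_eq_abs]
      refine intervalIntegral.norm_integral_le_of_norm_le_const fun q hq => ?_
      rw [uIoc_of_le hab.le] at hq
      have hqI : q ∈ Icc s t := ⟨by linarith [hq.1], by linarith [hq.2]⟩
      have e : w q * v q ω ^ 2 - v a ω ^ 2 * w q = w q * ((v q ω - v a ω) * (v q ω + v a ω)) := by ring
      rw [e, Real.norm_eq_abs, abs_mul]
      have hl := hL q hqI a haI ω
      have hL0 : 0 ≤ L := by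
        by_contra hn
        have : 0 < |q - a| := abs_pos.2 (by linarith [hq.1])
        nlinarith [abs_nonneg (v q ω - v a ω)]
      refine mul_le_mul (h.wabs q) ?_ (abs_nonneg _) hK
      rw [abs_mul]
      refine mul_le_mul (hl.trans ?_) ?_ (abs_nonneg _) (mul_nonneg hL0 (by linarith))
      · rw [abs_of_nonneg (by linarith [hq.1])]
        exact mul_le_mul_of_nonneg_left (by linarith [hq.2]) hL0
      · linarith [abs_add_le (v q ω) (v a ω), hv.bd q hqI ω, hv.bd a haI ω]
    rw [abs_of_pos (by linarith : 0 < b - a)] at d1 d2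
    have l1 := (h.fC b hbI).lip (Yp w W s x v b ω) (Yp w W s x v a ω + v a ω * A + (W b ω - W a ω))
    have e3 : Yp w W s x v b ω - (Yp w W s x v a ω + v a ω * A + (W b ω - W a ω)) =
      (∫ q in a..b, w q * v q ω) - v a ω * A := by
      simp only [Yp]; rw [← e1]; ring
    rw [e3] at l1
    have l2 := (abs_le.1 (l1.trans d1)).2
    have l3 := (abs_le.1 d2).1
    rw [← e2]
    nlinarith
  have i1 := h.J_int hv x hbI
  have i2 : Integrable (fun ω => f b (Yp w W s x v a ω + v a ω * A + (W b ω - W a ω)) - 1 / 2 * v a ω ^ 2 * A) P := by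
    have hva : Measurable (v a) := (hv.adap haI).mono (𝓕.le a) le_rfl
    have iv : Integrable (v a) P := Integrable.of_bound hva.aestronglyMeasurable C (.of_forall fun ω => hv.bd a haI ω)
    refine (h.f_int hbI (((h.Y_int hv x haI).add (iv.mul_const A)).add ((h.Wi b hbI).sub (h.Wi a haI)))).sub ?_
    refine Integrable.of_bound (by fun_prop) (1 / 2 * C ^ 2 * |A|) (.of_forall fun ω => ?_)
    rw [Real.norm_eq_abs, abs_mul, abs_mul, abs_pow, abs_of_pos (by norm_num : (0:ℝ) < 1 / 2)]
    have := pow_le_pow_left₀ (abs_nonneg _) (hv.bd a haI ω) 2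
    exact mul_le_mul_of_nonneg_right (mul_le_mul_of_nonneg_left this (by norm_num)) (abs_nonneg _)
  have i3 : Integrable (fun ω => 1 / 2 * ∫ q in s..a, w q * (v q ω) ^ 2) P :=
    ((h.wv2 hv).int_integrable le_rfl haI.1 haI.2 P).const_mul _
  have i4 : Integrable (fun ω => (f b (Yp w W s x v a ω + v a ω * A + (W b ω - W a ω)) - 1 / 2 * v a ω ^ 2 * A)
      - (1 / 2 * ∫ q in s..a, w q * (v q ω) ^ 2)) P := i2.sub i3
  have m := integral_mono i1 (i4.add (integrable_const _)) ib
  have s1 : ∫ ω, ((f b (Yp w W s x v a ω + v a ω * A + (W b ω - W a ω)) - 1 / 2 * v a ω ^ 2 * A)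
      - (1 / 2 * ∫ q in s..a, w q * (v q ω) ^ 2) + K * L * (1 + C) * (b - a) ^ 2) ∂P =
      ∫ ω, (f b (Yp w W s x v a ω + v a ω * A + (W b ω - W a ω)) - 1 / 2 * v a ω ^ 2 * A) ∂P
      - ∫ ω, (1 / 2 * ∫ q in s..a, w q * (v q ω) ^ 2) ∂P + K * L * (1 + C) * (b - a) ^ 2 := by
    rw [integral_add i4 (integrable_const _), integral_sub i2 i3]
    simp
  have s2 : Jf P w f W s x v a = ∫ ω, f a (Yp w W s x v a ω) ∂P -
      ∫ ω, (1 / 2 * ∫ q in s..a, w q * (v q ω) ^ 2) ∂P := integral_sub (h.fY_int hv x haI) i3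
  have s3 : Jf P w f W s x v b ≤ _ := m.trans_eq s1
  linarith

lemma SCtx.J_anti_lip (h : SCtx P 𝓕 w f f1 W s t K) (hv : Ctl 𝓕 s t C v) (hC : 0 ≤ C) (x : ℝ) {L : ℝ}
    (hL0 : 0 ≤ L)
    (hL : ∀ r ∈ Icc s t, ∀ r' ∈ Icc s t, ∀ ω, |v r ω - v r' ω| ≤ L * |r - r'|) {a b : ℝ}
    (ha : s ≤ a) (hab : a ≤ b) (hb : b ≤ t) :
    Jf P w f W s x v b ≤ Jf P w f W s x v a := by
  have hK := h.K0
  refine chain_le (F := Jf P w f W s x v) hab fun ε hε => ?_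
  set M := K * L * (1 + C)
  have hM : 0 ≤ M := by positivity
  refine ⟨ε / (M + 1), by positivity, fun a' b' h1 h2 h3 h4 => ?_⟩
  rcases h2.eq_or_lt with rfl | h2
  · simp
  refine (h.J_step hv x hL (by linarith) h2 (by linarith)).trans ?_
  rw [le_div_iff₀ (by positivity)] at h4
  change M * (b' - a') ^ 2 ≤ _
  nlinarith

/-- `J` is Lipschitz in the control -/
lemma SCtx.J_lip (h : SCtx P 𝓕 w f f1 W s t K) (hv : Ctl 𝓕 s t C v) (hv' : Ctl 𝓕 s t C v') (x : ℝ) {r : ℝ}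
    (hr : r ∈ Icc s t) :
    |Jf P w f W s x v r - Jf P w f W s x v' r| ≤ K * (1 + C) * ∫ ω, (∫ q in s..t, |v q ω - v' q ω|) ∂P := by
  have hsI : s ∈ Icc s t := ⟨le_rfl, h.st.le⟩
  have htI : t ∈ Icc s t := ⟨h.st.le, le_rfl⟩
  have hK := h.K0
  have hd : Ctl 𝓕 s t (2 * C) (fun r ω => |v r ω - v' r ω|) :=
    hv.comp hv' (k := fun _ x y => |x - y|) (by fun_prop) fun r hr x y hx hy => by
      rw [abs_abs]; linarith [abs_sub x y]
  rw [Jf, Jf, ← integral_sub (h.J_int hv x hr) (h.J_int hv' x hr), ← integral_const_mul, ← Real.norm_eq_abs]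
  refine norm_integral_le_of_norm_le ((hd.int_integrable le_rfl h.st.le le_rfl P).const_mul _) (.of_forall fun ω => ?_)
  have hC : 0 ≤ C := (abs_nonneg _).trans (hv.bd s hsI ω)
  have mono : ∫ q in s..r, |v q ω - v' q ω| ≤ ∫ q in s..t, |v q ω - v' q ω| :=
    intervalIntegral.integral_mono_interval le_rfl hr.1 hr.2 (.of_forall fun q => abs_nonneg _) (hd.ii hsI htI ω)
  have d1 : |(∫ q in s..r, w q * v q ω) - ∫ q in s..r, w q * v' q ω| ≤ K * ∫ q in s..r, |v q ω - v' q ω| := by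
    rw [← intervalIntegral.integral_sub ((h.wv hv).ii hsI hr ω) ((h.wv hv').ii hsI hr ω),
      ← intervalIntegral.integral_const_mul, ← Real.norm_eq_abs]
    refine intervalIntegral.norm_integral_le_of_norm_le hr.1 (.of_forall fun q hq => ?_)
      ((hd.ii hsI hr ω).const_mul K)
    rw [← mul_sub, Real.norm_eq_abs, abs_mul]
    exact mul_le_mul_of_nonneg_right (h.wabs q) (abs_nonneg _)
  have d2 : |(∫ q in s..r, w q * v q ω ^ 2) - ∫ q in s..r, w q * v' q ω ^ 2| ≤
      (K * (2 * C)) * ∫ q in s..r, |v q ω - v' q ω| := by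
    rw [← intervalIntegral.integral_sub ((h.wv2 hv).ii hsI hr ω) ((h.wv2 hv').ii hsI hr ω),
      ← intervalIntegral.integral_const_mul, ← Real.norm_eq_abs]
    refine intervalIntegral.norm_integral_le_of_norm_le hr.1 (.of_forall fun q hq => ?_)
      ((hd.ii hsI hr ω).const_mul _)
    have hqI : q ∈ Icc s t := ⟨by linarith [hq.1], by linarith [hq.2, hr.2]⟩
    have e : w q * v q ω ^ 2 - w q * v' q ω ^ 2 = w q * (v q ω + v' q ω) * (v q ω - v' q ω) := by ring
    rw [e, Real.norm_eq_abs, abs_mul, abs_mul]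
    refine mul_le_mul_of_nonneg_right (mul_le_mul (h.wabs q) ?_ (abs_nonneg _) hK) (abs_nonneg _)
    linarith [abs_add_le (v q ω) (v' q ω), hv.bd q hqI ω, hv'.bd q hqI ω]
  have l1 := (h.fC r hr).lip (Yp w W s x v r ω) (Yp w W s x v' r ω)
  have e3 : Yp w W s x v r ω - Yp w W s x v' r ω =
      (∫ q in s..r, w q * v q ω) - ∫ q in s..r, w q * v' q ω := by simp only [Yp]; ring
  rw [e3] at l1
  have m2 := mul_le_mul_of_nonneg_left mono (by positivity : 0 ≤ K * (1 + C))
  refine le_trans ?_ m2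
  have := abs_le.1 (l1.trans d1)
  have := abs_le.1 d2
  rw [Real.norm_eq_abs, abs_le]
  constructor <;> nlinarith

lemma SCtx.J_anti (h : SCtx P 𝓕 w f f1 W s t K) (hv : Ctl 𝓕 s t C v) (hC : 0 ≤ C) (x : ℝ) {a b : ℝ}
    (ha : s ≤ a) (hab : a ≤ b) (hb : b ≤ t) :
    Jf P w f W s x v b ≤ Jf P w f W s x v a := by
  have hst := h.st.le
  have hlim : ∀ r ∈ Icc s t, Tendsto (fun n => Jf P w f W s x (avg s t v n) r) atTop
      (nhds (Jf P w f W s x v r)) := fun r hr => by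
    rw [tendsto_iff_dist_tendsto_zero]
    refine squeeze_zero (fun _ => dist_nonneg) (fun n => h.J_lip (hv.avg hst n) hv x hr) ?_
    simpa using (hv.avg_L1 hst P).const_mul (K * (1 + C))
  refine le_of_tendsto_of_tendsto' (hlim b ⟨by linarith, hb⟩) (hlim a ⟨ha, by linarith⟩) fun n => ?_
  exact h.J_anti_lip (hv.avg hst n) hC x (L := 2 * C * ((n:ℝ) + 1)) (by positivity)
    (fun r _ r' _ ω => hv.avg_lip hst n ω r r') ha hab hb
end core


section core2
variable {Ω : Type*} {mΩ : MeasurableSpace Ω} {P : Measure Ω} [IsProbabilityMeasure P]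
  {𝓕 : Filtration ℝ mΩ} {w : ℝ → ℝ} {f f1 : ℝ → ℝ → ℝ} {W : ℝ → Ω → ℝ} {s t K : ℝ}
  {u : ℝ → Ω → ℝ} {x : ℝ}

lemma eq_zero_of_quad {G Q : ℝ} (h : ∀ ε : ℝ, ε * G ≤ ε ^ 2 * Q) : G = 0 := by
  have hQ : 0 ≤ Q := by
    have := h 1; have := h (-1); nlinarith
  have h1 := h (G / (Q + 1))
  have e1 : G / (Q + 1) * G = G ^ 2 / (Q + 1) := by ring
  have e2 : (G / (Q + 1)) ^ 2 * Q = G ^ 2 / (Q + 1) * (Q / (Q + 1)) := by field_simp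
  rw [e1, e2] at h1
  by_contra hG
  have hp : 0 < G ^ 2 / (Q + 1) := by positivity
  have : Q / (Q + 1) < 1 := by rw [div_lt_one (by positivity)]; linarith
  nlinarith

lemma SCtx.Psi_ctl (h : SCtx P 𝓕 w f f1 W s t K) (hu : Ctl 𝓕 s t 1 u) :
    Ctl 𝓕 s t 1 (fun r ω => f1 r (Yp w W s x u r ω)) := by
  refine Ctl.of_cont (fun ω => ?_) (fun r hr => ?_) fun r hr ω => (h.fC r hr).2.1 _
  · exact h.f1c.comp (f := fun r => (r, Yp w W s x u r ω)) (continuousOn_id.prodMk (h.Y_cont hu x ω)) fun r hr => ⟨hr, trivial⟩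
  · have : Continuous (f1 r) := (LipschitzWith.of_dist_le_mul (K := 1) fun a b => by
      simpa [Real.dist_eq] using (h.fC r hr).2.2 a b).continuous
    exact this.measurable.comp (h.Y_meas hu x hr)

lemma SCtx.J_eq (h : SCtx P 𝓕 w f f1 W s t K) (hu : Ctl 𝓕 s t 1 u)
    (hJ : Jf P w f W s x u t = f s x) {r : ℝ} (hr : r ∈ Icc s t) : Jf P w f W s x u r = f s x := by
  have h1 := h.J_anti hu zero_le_one x hr.1 hr.2 le_rfl
  have h2 := h.J_anti hu zero_le_one x le_rfl hr.1 hr.2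
  rw [h.J_s] at h2
  linarith

lemma SCtx.first_order (h : SCtx P 𝓕 w f f1 W s t K) (hu : Ctl 𝓕 s t 1 u)
    (hJ : Jf P w f W s x u t = f s x) {g : ℝ → Ω → ℝ} {H : ℝ} (hH : 0 ≤ H) (hg : Ctl 𝓕 s t H g)
    {r : ℝ} (hr : r ∈ Icc s t) :
    ∫ ω, (f1 r (Yp w W s x u r ω) * (∫ q in s..r, w q * g q ω) - ∫ q in s..r, w q * (u q ω * g q ω)) ∂P = 0 := by
  have hsI : s ∈ Icc s t := ⟨le_rfl, h.st.le⟩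
  have hug : Ctl 𝓕 s t H (fun r ω => u r ω * g r ω) :=
    hu.comp hg (k := fun _ x y => x * y) (by fun_prop) fun r _ x y hx hy => by
      rw [abs_mul]; nlinarith [abs_nonneg x, abs_nonneg y]
  have iI := (h.wv hg).int_integrable le_rfl hr.1 hr.2 P
  have mI := ((h.wv hg).int_meas le_rfl hr.1 hr.2).mono (𝓕.le r) le_rfl
  have mP := ((h.Psi_ctl (x := x) hu).adap hr).mono (𝓕.le r) le_rfl
  have i1 : Integrable (fun ω => f1 r (Yp w W s x u r ω) * (∫ q in s..r, w q * g q ω)) P :=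
    iI.bdd_mul (c := 1) mP.aestronglyMeasurable (.of_forall fun ω => (h.fC r hr).2.1 _)
  have i2 := (h.wv hug).int_integrable le_rfl hr.1 hr.2 P
  have i12 : Integrable (fun ω => f1 r (Yp w W s x u r ω) * (∫ q in s..r, w q * g q ω) -
    ∫ q in s..r, w q * (u q ω * g q ω)) P := i1.sub i2
  have i3 : Integrable (fun ω => (∫ q in s..r, w q * g q ω) ^ 2) P := by
    refine Integrable.of_bound (mI.pow_const 2).aestronglyMeasurable ((K * H * (r - s)) ^ 2) (.of_forall fun ω => ?_)
    rw [norm_pow]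
    exact pow_le_pow_left₀ (norm_nonneg _) ((h.wv hg).int_bd le_rfl hr.1 hr.2 ω) 2
  have i4 := (h.wv2 hg).int_integrable le_rfl hr.1 hr.2 P
  have i5 : Integrable (fun ω => (∫ q in s..r, w q * g q ω) ^ 2 + 1 / 2 * ∫ q in s..r, w q * (g q ω) ^ 2) P :=
    i3.add (i4.const_mul _)
  refine eq_zero_of_quad (Q := ∫ ω, ((∫ q in s..r, w q * g q ω) ^ 2 + 1 / 2 * ∫ q in s..r, w q * (g q ω) ^ 2) ∂P) fun ε => ?_
  have hv : Ctl 𝓕 s t (1 + |ε| * H) (fun r ω => u r ω + ε * g r ω) :=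
    hu.comp hg (k := fun _ x y => x + ε * y) (by fun_prop) fun r _ x y hx hy => by
      refine (abs_add_le _ _).trans (add_le_add hx ?_)
      rw [abs_mul]; exact mul_le_mul_of_nonneg_left hy (abs_nonneg _)
  have hle : Jf P w f W s x (fun r ω => u r ω + ε * g r ω) r ≤ f s x := by
    rw [← h.J_s x (fun r ω => u r ω + ε * g r ω)]
    exact h.J_anti hv (by positivity) x le_rfl hr.1 hr.2
  rw [← h.J_eq hu hJ hr] at hle
  have pt : ∀ ω, (f r (Yp w W s x u r ω) - 1 / 2 * ∫ q in s..r, w q * (u q ω) ^ 2)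
      + ε * (f1 r (Yp w W s x u r ω) * (∫ q in s..r, w q * g q ω) - ∫ q in s..r, w q * (u q ω * g q ω))
      - ε ^ 2 * ((∫ q in s..r, w q * g q ω) ^ 2 + 1 / 2 * ∫ q in s..r, w q * (g q ω) ^ 2) ≤
      f r (Yp w W s x (fun r ω => u r ω + ε * g r ω) r ω)
        - 1 / 2 * ∫ q in s..r, w q * (u q ω + ε * g q ω) ^ 2 := by
    intro ω
    have a1 := (h.wv hu).ii hsI hr ω
    have a2 := (h.wv hg).ii hsI hr ω
    have b1 := (h.wv2 hu).ii hsI hr ω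
    have b2 := (h.wv hug).ii hsI hr ω
    have b3 := (h.wv2 hg).ii hsI hr ω
    have eY : Yp w W s x (fun r ω => u r ω + ε * g r ω) r ω =
        Yp w W s x u r ω + ε * ∫ q in s..r, w q * g q ω := by
      have : ∫ q in s..r, w q * (u q ω + ε * g q ω) =
          (∫ q in s..r, w q * u q ω) + ε * ∫ q in s..r, w q * g q ω := by
        rw [← intervalIntegral.integral_const_mul, ← intervalIntegral.integral_add a1 (a2.const_mul ε)]
        congr 1; funext q; ring
      simp only [Yp]; rw [this]; ring
    have eQ : ∫ q in s..r, w q * (u q ω + ε * g q ω) ^ 2 = (∫ q in s..r, w q * (u q ω) ^ 2)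
        + 2 * ε * (∫ q in s..r, w q * (u q ω * g q ω)) + ε ^ 2 * ∫ q in s..r, w q * (g q ω) ^ 2 := by
      rw [← intervalIntegral.integral_const_mul, ← intervalIntegral.integral_const_mul,
        ← intervalIntegral.integral_add b1 (b2.const_mul _),
        ← intervalIntegral.integral_add (b1.add (b2.const_mul _)) (b3.const_mul _)]
      congr 1; funext q; ring
    rw [eY, eQ]
    have := (abs_le.1 ((h.fC r hr).1 (Yp w W s x u r ω) (ε * ∫ q in s..r, w q * g q ω))).1
    nlinarith
  have j1 := h.J_int hu x hr
  have j2 : Integrable (fun ω => (f r (Yp w W s x u r ω) - 1 / 2 * ∫ q in s..r, w q * (u q ω) ^ 2)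
      + ε * (f1 r (Yp w W s x u r ω) * (∫ q in s..r, w q * g q ω) - ∫ q in s..r, w q * (u q ω * g q ω))) P :=
    j1.add (i12.const_mul ε)
  have m := integral_mono (j2.sub (i5.const_mul (ε ^ 2))) (h.J_int hv x hr) pt
  have s1 := integral_sub j2 (i5.const_mul (ε ^ 2))
  rw [integral_add j1 (i12.const_mul ε), integral_const_mul, integral_const_mul] at s1
  have m2 := s1.symm.trans_le m
  simp only [Jf] at hle
  linarith

/-- the maximizer is of feedback form -/
lemma SCtx.feedback (h : SCtx P 𝓕 w f f1 W s t K) (hu : Ctl 𝓕 s t 1 u)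
    (hJ : Jf P w f W s x u t = f s x) :
    ∫ ω, (∫ r in s..t, w r * (u r ω - f1 r (Yp w W s x u r ω)) ^ 2) ∂P ≤ 0 := by
  have hst := h.st.le
  have hsI : s ∈ Icc s t := ⟨le_rfl, hst⟩
  have htI : t ∈ Icc s t := ⟨hst, le_rfl⟩
  have hK := h.K0
  set Ψ : ℝ → Ω → ℝ := fun r ω => f1 r (Yp w W s x u r ω) with hΨ
  have cΨ : Ctl 𝓕 s t 1 Ψ := h.Psi_ctl hu
  set D : ℝ → Ω → ℝ := fun r ω => u r ω - Ψ r ω with hD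
  have cD : Ctl 𝓕 s t 2 D := hu.comp cΨ (k := fun _ x y => x - y) (by fun_prop) fun r _ x y hx hy => by
    linarith [abs_sub x y]
  -- modulus of continuity
  set R : ℝ → Ω → ℝ := fun r ω => Ψ (max s (min r t)) ω with hR
  have Rc : ∀ ω, Continuous (fun r => R r ω) := fun ω => by
    have : ContinuousOn (fun r => Ψ r ω) (Icc s t) :=
      h.f1c.comp (f := fun r => (r, Yp w W s x u r ω)) (continuousOn_id.prodMk (h.Y_cont hu x ω)) fun r hr => ⟨hr, trivial⟩
    exact this.comp_continuous (by fun_prop) fun r => clamp_mem hst r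
  have Rm : ∀ r, Measurable (R r) := fun r => (cΨ.meas' htI).comp measurable_prodMk_left
  have Rb : ∀ r ω, |R r ω| ≤ 1 := fun r ω => cΨ.bd _ (clamp_mem hst r) ω
  have Rb2 : ∀ a b ω, |R a ω - R b ω| ≤ 2 := fun a b ω => by
    linarith [abs_sub (R a ω) (R b ω), Rb a ω, Rb b ω]
  set m : ℝ × ℝ → ℝ := fun p => ∫ ω, |R p.1 ω - R p.2 ω| ∂P with hm
  have mc : Continuous m := by
    refine continuous_of_dominated (bound := fun _ => 2) (fun p => ?_) (fun p => .of_forall fun ω => ?_)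
      (integrable_const _) (.of_forall fun ω => ?_)
    · exact (((Rm p.1).sub (Rm p.2)).abs).aestronglyMeasurable
    · rw [Real.norm_eq_abs, abs_abs]; exact Rb2 _ _ ω
    · have := Rc ω
      fun_prop
  have mu : ∀ ε > 0, ∃ δ > 0, ∀ a ∈ Icc s t, ∀ b ∈ Icc s t, |a - b| < δ → m (a, b) ≤ ε := by
    intro ε hε
    have huc := (isCompact_Icc (a := s) (b := t)).prod (isCompact_Icc (a := s) (b := t)) |>.uniformContinuousOn_of_continuous mc.continuousOn
    obtain ⟨δ, hδ, hh⟩ := Metric.uniformContinuousOn_iff.1 huc ε hε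
    refine ⟨δ, hδ, fun a ha b hb hab => ?_⟩
    have := hh (a, b) ⟨ha, hb⟩ (a, a) ⟨ha, ha⟩ (by
      rw [Prod.dist_eq]; simp [Real.dist_eq, abs_sub_comm b a, hab, hδ])
    have z : m (a, a) = 0 := by simp [hm]
    rw [z, Real.dist_eq, sub_zero] at this
    exact (le_abs_self _).trans this.le
  have main : ∀ a b, s ≤ a → a ≤ b → b ≤ t →
      ∫ ω, (∫ r in a..b, w r * D r ω ^ 2) ∂P ≤ 2 * K * ∫ r in a..b, m (b, r) := by
    intro a b ha hab hb
    have haI : a ∈ Icc s t := ⟨ha, by linarith⟩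
    have hbI : b ∈ Icc s t := ⟨by linarith, hb⟩
    set g : ℝ → Ω → ℝ := fun r ω => (Ioc a b).indicator (fun _ => (1:ℝ)) r * D r ω with hg
    have cg : Ctl 𝓕 s t 2 g := by
      refine cD.comp cD (k := fun r x _ => (Ioc a b).indicator (fun _ => (1:ℝ)) r * x) ?_ ?_
      · have : Measurable ((Ioc a b).indicator (fun _ => (1:ℝ))) := measurable_const.indicator measurableSet_Ioc
        fun_prop
      · intro r _ x y hx _
        by_cases hr : r ∈ Ioc a b
        · simpa [hr] using hx
        · simp [hr]
    have fo := h.first_order hu hJ zero_le_two cg hbI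
    -- integrals of g localise
    have loc : ∀ k : ℝ → ℝ, IntervalIntegrable k volume s b → ∫ q in s..b, (Ioc a b).indicator (fun _ => (1:ℝ)) q * k q = ∫ q in a..b, k q := by
      intro k _
      have : (fun q => (Ioc a b).indicator (fun _ => (1:ℝ)) q * k q) = (Ioc a b).indicator k := by
        funext q; by_cases hq : q ∈ Ioc a b <;> simp [hq]
      rw [this, intervalIntegral.integral_of_le (by linarith), intervalIntegral.integral_of_le hab,
        setIntegral_indicator measurableSet_Ioc]
      congr 2
      exact inter_eq_right.2 (Ioc_subset_Ioc_left ha)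
    have cuD : Ctl 𝓕 s t 2 (fun r ω => u r ω * D r ω) :=
      hu.comp cD (k := fun _ x y => x * y) (by fun_prop) fun r _ x y hx hy => by
        rw [abs_mul]; nlinarith [abs_nonneg x, abs_nonneg y]
    have l1 : ∀ ω, ∫ q in s..b, w q * g q ω = ∫ q in a..b, w q * D q ω := fun ω => by
      rw [← loc _ ((h.wv cD).ii hsI hbI ω)]
      congr 1; funext q; simp only [hg]; ring
    have l2 : ∀ ω, ∫ q in s..b, w q * (u q ω * g q ω) = ∫ q in a..b, w q * (u q ω * D q ω) := fun ω => by
      rw [← loc _ ((h.wv cuD).ii hsI hbI ω)]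
      congr 1; funext q; simp only [hg]; ring
    simp only [l1, l2] at fo
    have Rjm : Measurable (fun p : ℝ × Ω => |R b p.2 - R p.1 p.2|) :=
      (((Rm b).comp measurable_snd).sub (cΨ.meas' htI)).abs
    have Rint : Integrable (fun p : ℝ × Ω => |R b p.2 - R p.1 p.2|)
        ((volume.restrict (Set.uIoc a b)).prod P) := by
      have : IsFiniteMeasure (volume.restrict (Set.uIoc a b)) := by
        rw [Set.uIoc_of_le hab]; infer_instance
      refine Integrable.of_bound Rjm.aestronglyMeasurable 2 (.of_forall fun p => ?_)
      rw [Real.norm_eq_abs, abs_abs]; exact Rb2 _ _ _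
    have swap : ∫ r in a..b, m (b, r) = ∫ ω, (∫ r in a..b, |R b ω - R r ω|) ∂P :=
      intervalIntegral_integral_swap (f := fun r ω => |R b ω - R r ω|) Rint
    have iD := (h.wv cD).int_integrable ha hab hb P
    have iuD := (h.wv cuD).int_integrable ha hab hb P
    have iDD := (h.wv2 cD).int_integrable ha hab hb P
    have i1 : Integrable (fun ω => Ψ b ω * ∫ q in a..b, w q * D q ω) P :=
      iD.bdd_mul (c := 1) ((cΨ.adap hbI).mono (𝓕.le b) le_rfl).aestronglyMeasurable
        (.of_forall fun ω => cΨ.bd b hbI ω)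
    have i2 : Integrable (fun ω => Ψ b ω * (∫ q in a..b, w q * D q ω)
        - ∫ q in a..b, w q * (u q ω * D q ω)) P := i1.sub iuD
    have i3 : Integrable (fun ω => ∫ r in a..b, |R b ω - R r ω|) P := by
      refine Integrable.of_bound (meas_int Rjm a b).aestronglyMeasurable (2 * |b - a|) (.of_forall fun ω => ?_)
      refine intervalIntegral.norm_integral_le_of_norm_le_const fun q hq => ?_
      rw [Real.norm_eq_abs, abs_abs]; exact Rb2 _ _ _
    have pt : ∀ ω, (∫ r in a..b, w r * D r ω ^ 2) + (Ψ b ω * (∫ q in a..b, w q * D q ω)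
        - ∫ q in a..b, w q * (u q ω * D q ω)) ≤ 2 * K * ∫ r in a..b, |R b ω - R r ω| := by
      intro ω
      have q1 := (h.wv cD).ii haI hbI ω
      have q2 := (h.wv cuD).ii haI hbI ω
      have q3 := (h.wv2 cD).ii haI hbI ω
      have q4 : IntervalIntegrable (fun r => |R b ω - R r ω|) volume a b := by
        have := Rc ω
        exact (by fun_prop : Continuous fun r => |R b ω - R r ω|).intervalIntegrable _ _
      rw [← intervalIntegral.integral_const_mul, ← intervalIntegral.integral_sub (q1.const_mul _) q2,
        ← intervalIntegral.integral_add q3 ((q1.const_mul _).sub q2), ← intervalIntegral.integral_const_mul]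
      refine intervalIntegral.integral_mono_on hab (q3.add ((q1.const_mul _).sub q2)) (q4.const_mul _) fun r hr => ?_
      have hrI : r ∈ Icc s t := ⟨by linarith [hr.1], by linarith [hr.2]⟩
      have e1 : R r ω = Ψ r ω := by simp only [hR]; rw [clamp_eq hrI]
      have e2 : R b ω = Ψ b ω := by simp only [hR]; rw [clamp_eq hbI]
      rw [e1, e2]
      have e3 : w r * D r ω ^ 2 + (Ψ b ω * (w r * D r ω) - w r * (u r ω * D r ω)) =
        w r * (D r ω * (Ψ b ω - Ψ r ω)) := by simp only [hD]; ring
      rw [e3]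
      refine (le_abs_self _).trans ?_
      rw [abs_mul, abs_mul]
      have := h.wabs r
      have := cD.bd r hrI ω
      calc |w r| * (|D r ω| * |Ψ b ω - Ψ r ω|) ≤ K * (2 * |Ψ b ω - Ψ r ω|) := by gcongr
        _ = _ := by ring
    have M := integral_mono (iDD.add i2) (i3.const_mul (2 * K)) pt
    have S := integral_add iDD i2
    have M2 := S.symm.trans_le M
    rw [integral_const_mul, ← swap] at M2
    linarith
  refine chain_le (F := fun r => ∫ ω, (∫ q in s..r, w q * D q ω ^ 2) ∂P) hst ?_ |>.trans (by simp)
  intro ε hε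
  obtain ⟨δ, hδ, hh⟩ := mu (ε / (2 * K + 1)) (by positivity)
  refine ⟨δ / 2, by positivity, fun a b ha hab hb hd => ?_⟩
  have haI : a ∈ Icc s t := ⟨ha, by linarith⟩
  have hbI : b ∈ Icc s t := ⟨by linarith, hb⟩
  have e : (∫ ω, (∫ q in s..b, w q * D q ω ^ 2) ∂P) - (∫ ω, (∫ q in s..a, w q * D q ω ^ 2) ∂P)
      = ∫ ω, (∫ r in a..b, w r * D r ω ^ 2) ∂P := by
    rw [← integral_sub ((h.wv2 cD).int_integrable le_rfl hbI.1 hb P)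
      ((h.wv2 cD).int_integrable le_rfl ha haI.2 P)]
    congr 1; funext ω
    have := intervalIntegral.integral_add_adjacent_intervals ((h.wv2 cD).ii hsI haI ω) ((h.wv2 cD).ii haI hbI ω)
    linarith
  rw [e]
  have h1 := main a b ha hab hb
  have h2 : ∫ r in a..b, m (b, r) ≤ ∫ r in a..b, ε / (2 * K + 1) := by
    refine intervalIntegral.integral_mono_on hab ?_ intervalIntegrable_const fun r hr => ?_
    · exact (mc.comp (by fun_prop : Continuous fun r : ℝ => (b, r))).intervalIntegrable _ _
    · refine hh b hbI r ⟨by linarith [hr.1], by linarith [hr.2]⟩ ?_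
      rw [abs_of_nonneg (by linarith [hr.2])]; linarith [hr.1]
  rw [intervalIntegral.integral_const, smul_eq_mul] at h2
  have h3 : 2 * K * ((b - a) * (ε / (2 * K + 1))) ≤ ε * (b - a) := by
    have : 2 * K * ((b - a) * (ε / (2 * K + 1))) = (2 * K / (2 * K + 1)) * (ε * (b - a)) := by
      field_simp
    rw [this]
    refine mul_le_of_le_one_left (mul_nonneg hε.le (by linarith)) ?_
    rw [div_le_one (by positivity)]; linarith
  have h4 := mul_le_mul_of_nonneg_left h2 (by positivity : 0 ≤ 2 * K)
  linarith
end core2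


section core3
variable {Ω : Type*} {mΩ : MeasurableSpace Ω} {P : Measure Ω} [IsProbabilityMeasure P]
  {𝓕 : Filtration ℝ mΩ} {w : ℝ → ℝ} {f f1 : ℝ → ℝ → ℝ} {W : ℝ → Ω → ℝ} {s t K : ℝ}
  {u : ℝ → Ω → ℝ} {x : ℝ}

lemma SCtx.unique (h : SCtx P 𝓕 w f f1 W s t K) (hu : Ctl 𝓕 s t 1 u)
    (hJ : Jf P w f W s x u t = f s x) (hw : ∀ r ∈ Icc s t, 0 < w r)
    (hsm : ∫ r in s..t, w r < 1) {X : ℝ → Ω → ℝ}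
    (hXc : ∀ ω, ContinuousOn (fun r => X r ω) (Icc s t))
    (hX : ∀ ω, ∀ r ∈ Icc s t, X r ω = x + (∫ v in s..r, w v * f1 v (X v ω)) + W r ω) :
    ∫ ω, (∫ r in s..t, (u r ω - f1 r (X r ω)) ^ 2) ∂P = 0 := by
  have hst := h.st.le
  have hsI : s ∈ Icc s t := ⟨le_rfl, hst⟩
  have htI : t ∈ Icc s t := ⟨hst, le_rfl⟩
  have cΨ : Ctl 𝓕 s t 1 (fun r ω => f1 r (Yp w W s x u r ω)) := h.Psi_ctl hu
  have cD : Ctl 𝓕 s t 2 (fun r ω => u r ω - f1 r (Yp w W s x u r ω)) :=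
    hu.comp cΨ (k := fun _ x y => x - y) (by fun_prop) fun r _ x y hx hy => by
      linarith [abs_sub x y]
  have nn : ∀ ω, 0 ≤ ∫ r in s..t, w r * (u r ω - f1 r (Yp w W s x u r ω)) ^ 2 := fun ω =>
    intervalIntegral.integral_nonneg hst fun r _ => mul_nonneg (h.w0 r) (sq_nonneg _)
  have z : ∫ ω, (∫ r in s..t, w r * (u r ω - f1 r (Yp w W s x u r ω)) ^ 2) ∂P = 0 :=
    le_antisymm (h.feedback hu hJ) (integral_nonneg nn)
  rw [integral_eq_zero_iff_of_nonneg nn ((h.wv2 cD).int_integrable le_rfl hst le_rfl P)] at z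
  refine integral_eq_zero_of_ae ?_
  filter_upwards [z] with ω hω
  have ae1 := (intervalIntegral.integral_eq_zero_iff_of_le_of_nonneg_ae hst
    (.of_forall fun r => mul_nonneg (h.w0 r) (sq_nonneg _)) ((h.wv2 cD).ii hsI htI ω)).1 hω
  have ae2 : ∀ᵐ r, r ∈ Ioc s t → u r ω = f1 r (Yp w W s x u r ω) := by
    filter_upwards [(ae_restrict_iff' measurableSet_Ioc).1 ae1] with r hr hrI
    have h1 := hr hrI
    have h2 := hw r ⟨hrI.1.le, hrI.2⟩
    simp only [Pi.zero_apply, mul_eq_zero, h2.ne', false_or] at h1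
    have := pow_eq_zero_iff (two_ne_zero) |>.1 h1
    linarith
  have cc : ∀ {Z : ℝ → ℝ}, ContinuousOn Z (Icc s t) → ContinuousOn (fun r => f1 r (Z r)) (Icc s t) :=
    fun hZ => h.f1c.comp (f := fun r => (r, _)) (continuousOn_id.prodMk hZ) fun r hr => ⟨hr, trivial⟩
  have ii : ∀ {Z : ℝ → ℝ}, ContinuousOn Z (Icc s t) → ∀ r ∈ Icc s t,
      IntervalIntegrable (fun q => w q * f1 q (Z q)) volume s r := by
    intro Z hZ r hr
    refine (h.wi s r).mul_continuousOn ((cc hZ).mono ?_)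
    rw [Set.uIcc_of_le hr.1]; exact Icc_subset_Icc_right hr.2
  have Yc := h.Y_cont hu x ω
  have hY : ∀ r ∈ Icc s t, Yp w W s x u r ω =
      x + (∫ v in s..r, w v * f1 v (Yp w W s x u v ω)) + W r ω := by
    intro r hr
    have : ∫ v in s..r, w v * u v ω = ∫ v in s..r, w v * f1 v (Yp w W s x u v ω) := by
      refine intervalIntegral.integral_congr_ae ?_
      filter_upwards [ae2] with q hq hq2
      rw [Set.uIoc_of_le hr.1] at hq2
      rw [hq ⟨hq2.1, hq2.2.trans hr.2⟩]
    rw [← this, Yp]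
  have YX : ∀ r ∈ Icc s t, Yp w W s x u r ω = X r ω := by
    obtain ⟨r0, hr0, hm⟩ := isCompact_Icc.exists_isMaxOn ⟨s, hsI⟩ ((Yc.sub (hXc ω)).abs)
    set M := |Yp w W s x u r0 ω - X r0 ω| with hM
    have hle : ∀ r ∈ Icc s t, |Yp w W s x u r ω - X r ω| ≤ M := fun r hr => hm hr
    have hM0 : 0 ≤ M := abs_nonneg _
    have bound : M ≤ M * ∫ r in s..t, w r := by
      have e : Yp w W s x u r0 ω - X r0 ω =
          ∫ v in s..r0, (w v * f1 v (Yp w W s x u v ω) - w v * f1 v (X v ω)) := by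
        rw [intervalIntegral.integral_sub (ii Yc r0 hr0) (ii (hXc ω) r0 hr0), hY r0 hr0, hX ω r0 hr0]
        ring
      calc M = |∫ v in s..r0, (w v * f1 v (Yp w W s x u v ω) - w v * f1 v (X v ω))| := by rw [hM, e]
        _ ≤ ∫ v in s..r0, |w v * f1 v (Yp w W s x u v ω) - w v * f1 v (X v ω)| :=
          intervalIntegral.abs_integral_le_integral_abs hr0.1
        _ ≤ ∫ v in s..r0, M * w v := by
          refine intervalIntegral.integral_mono_on hr0.1 ((ii Yc r0 hr0).sub (ii (hXc ω) r0 hr0)).abs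
            ((h.wi _ _).const_mul _) fun v hv => ?_
          have hvI : v ∈ Icc s t := ⟨hv.1, hv.2.trans hr0.2⟩
          rw [← mul_sub, abs_mul, abs_of_nonneg (h.w0 v), mul_comm]
          exact mul_le_mul_of_nonneg_right (((h.fC v hvI).2.2 _ _).trans (hle v hvI)) (h.w0 v)
        _ = M * ∫ v in s..r0, w v := intervalIntegral.integral_const_mul _ _
        _ ≤ M * ∫ r in s..t, w r := by
          refine mul_le_mul_of_nonneg_left ?_ hM0
          exact intervalIntegral.integral_mono_interval le_rfl hr0.1 hr0.2 (.of_forall h.w0) (h.wi _ _)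
    have hMz : M = 0 := by nlinarith
    intro r hr
    have := hle r hr
    rw [hMz] at this
    have := abs_nonpos_iff.1 this
    linarith
  change ∫ r in s..t, (u r ω - f1 r (X r ω)) ^ 2 = 0
  rw [← intervalIntegral.integral_zero (a := s) (b := t) (μ := volume) (E := ℝ)]
  refine intervalIntegral.integral_congr_ae ?_
  filter_upwards [ae2] with q hq hq2
  rw [Set.uIoc_of_le hst] at hq2
  rw [hq hq2, YX q ⟨hq2.1.le, hq2.2⟩]
  simp
end core3


lemma step_indep {Ω : Type*} {m : MeasurableSpace Ω} {mΩ : MeasurableSpace Ω} {P : Measure Ω}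
    [IsProbabilityMeasure P] (hm : m ≤ mΩ) {f f1 fa fa1 : ℝ → ℝ} (hf : C1Q f f1) (hfa : C1Q fa fa1)
    {τ A : ℝ} (ineq : ∀ z c, ∫ y, f (z + c * A + y) ∂(nG τ) - 1 / 2 * c ^ 2 * A ≤ fa z)
    {N : Ω → ℝ} (hN : Measurable N) (law : P.map N = nG τ)
    (ind : Indep (MeasurableSpace.comap N inferInstance) m P) {Z c : Ω → ℝ} {C : ℝ}
    (hZ : Measurable[m] Z) (hZi : Integrable Z P) (hc : Measurable[m] c) (hC : ∀ ω, |c ω| ≤ C) :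
    ∫ ω, (f (Z ω + c ω * A + N ω) - 1 / 2 * c ω ^ 2 * A) ∂P ≤ ∫ ω, fa (Z ω) ∂P := by
  have hZ' := hZ.mono hm le_rfl
  have hc' := hc.mono hm le_rfl
  set V : Ω → ℝ × ℝ := fun ω => (Z ω, c ω) with hV
  have Vm : Measurable V := hZ'.prodMk hc'
  have Vm' : Measurable[m] V := by
    exact Measurable.prodMk hZ hc
  have hVN : IndepFun V N P := by
    rw [IndepFun_iff_Indep]
    exact indep_of_indep_of_le_left ind.symm Vm'.comap_le
  have hprod := (indepFun_iff_map_prod_eq_prod_map_map Vm.aemeasurable hN.aemeasurable).1 hVN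
  rw [law] at hprod
  have := Measure.isProbabilityMeasure_map (μ := P) Vm.aemeasurable
  have hfc := hf.cont
  have hfac := hfa.cont
  have hNi : Integrable N P := by
    have h1 := nG_int_id τ
    rw [← law] at h1
    exact h1.comp_measurable hN
  set G : (ℝ × ℝ) × ℝ → ℝ := fun q => f (q.1.1 + q.1.2 * A + q.2) - 1 / 2 * q.1.2 ^ 2 * A with hG
  have Gc : Continuous G := by fun_prop
  have VNm : Measurable (fun ω => (V ω, N ω)) := Vm.prodMk hN
  have i0 : Integrable (fun ω => c ω * A) P := 
    (Integrable.of_bound hc'.aestronglyMeasurable C (.of_forall hC)).mul_const A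
  have i1 : Integrable (fun ω => f (Z ω + c ω * A + N ω)) P := by
    have iz : Integrable (fun ω => Z ω + c ω * A + N ω) P := (hZi.add i0).add hNi
    refine ((integrable_const |f 0|).add iz.abs).mono'
      (hfc.comp_aestronglyMeasurable iz.aestronglyMeasurable) (.of_forall fun ω => ?_)
    simpa using hf.growth 0 (Z ω + c ω * A + N ω)
  have i2 : Integrable (fun ω => 1 / 2 * c ω ^ 2 * A) P := by
    have : Integrable (fun ω => c ω ^ 2) P := by
      refine Integrable.of_bound (hc'.pow_const 2).aestronglyMeasurable (C ^ 2) (.of_forall fun ω => ?_)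
      rw [norm_pow]
      exact pow_le_pow_left₀ (norm_nonneg _) (hC ω) 2
    exact (this.const_mul _).mul_const A
  have iG : Integrable G ((P.map V).prod (nG τ)) := by
    rw [← hprod, integrable_map_measure Gc.aestronglyMeasurable VNm.aemeasurable]
    exact i1.sub i2
  have iF : Integrable (fun p : ℝ × ℝ => fa p.1) (P.map V) := by
    rw [integrable_map_measure (by fun_prop) Vm.aemeasurable]
    refine ((integrable_const |fa 0|).add hZi.abs).mono'
      (hfac.comp_aestronglyMeasurable hZi.aestronglyMeasurable) (.of_forall fun ω => ?_)
    simpa using hfa.growth 0 (Z ω)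
  calc ∫ ω, (f (Z ω + c ω * A + N ω) - 1 / 2 * c ω ^ 2 * A) ∂P
      = ∫ q, G q ∂((P.map V).prod (nG τ)) := by
        rw [← hprod, integral_map VNm.aemeasurable Gc.aestronglyMeasurable]
    _ = ∫ p, ∫ y, G (p, y) ∂(nG τ) ∂(P.map V) := integral_prod _ iG
    _ ≤ ∫ p, fa p.1 ∂(P.map V) := by
        refine integral_mono iG.integral_prod_left iF fun p => ?_
        simp only [hG]
        rw [integral_sub (hf.int τ _) (integrable_const _)]
        simpa using ineq p.1 p.2
    _ = ∫ ω, fa (Z ω) ∂P := integral_map Vm.aemeasurable (by fun_prop)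

/-- the drift density -/
def wFn (β : ℕ → ℝ) (μ : Measure ℝ) : ℝ → ℝ :=
  (Icc (0:ℝ) 1).indicator fun r => distF μ r * zetaFn β r

lemma wFn_eq (β : ℕ → ℝ) (μ : Measure ℝ) {r : ℝ} (hr : r ∈ Icc (0:ℝ) 1) :
    wFn β μ r = distF μ r * zetaFn β r := indicator_of_mem hr _

lemma wFn_int (β : ℕ → ℝ) (μ : Measure ℝ) {a b : ℝ} (ha : a ∈ Icc (0:ℝ) 1) (hb : b ∈ Icc (0:ℝ) 1)
    (g : ℝ → ℝ) : ∫ r in a..b, distF μ r * zetaFn β r * g r = ∫ r in a..b, wFn β μ r * g r := by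
  refine intervalIntegral.integral_congr fun r hr => ?_
  rw [wFn_eq β μ (uIcc_subset_Icc ha hb hr)]

lemma wFn_int1 (β : ℕ → ℝ) (μ : Measure ℝ) {a b : ℝ} (ha : a ∈ Icc (0:ℝ) 1) (hb : b ∈ Icc (0:ℝ) 1) :
    ∫ r in a..b, distF μ r * zetaFn β r = ∫ r in a..b, wFn β μ r := by
  simpa using wFn_int β μ ha hb (fun _ => 1)

lemma wFn_meas {β : ℕ → ℝ} (hβ : ValidBeta β) {μ : Measure ℝ} (hμ : MemM μ) : Measurable (wFn β μ) := by
  have h1 : wFn β μ = fun r => distF μ r * (Icc (0:ℝ) 1).indicator (zetaFn β) r := by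
    funext r
    by_cases hr : r ∈ Icc (0:ℝ) 1 <;> simp [wFn, hr]
  rw [h1]
  refine (distF_mono hμ).measurable.mul ?_
  have := (zeta_continuousOn hβ).measurable_piecewise (g := fun _ => (0:ℝ)) continuousOn_const measurableSet_Icc
  convert this using 1
  funext r
  by_cases hr : r ∈ Icc (0:ℝ) 1 <;> simp [hr]

lemma mk_ctx {Ω : Type*} [mΩ : MeasurableSpace Ω] (P : Measure Ω) [IsProbabilityMeasure P]
    (β : ℕ → ℝ) (hβ : ValidBeta β)
    (Φ : Measure ℝ → ℝ → ℝ → ℝ) (hΦ : IsParisiFamily β Φ)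
    (B : ℝ → Ω → ℝ) (hB : IsStdBM P B)
    (𝓕 : Filtration ℝ mΩ)
    (h𝓕 : ∀ r : ℝ, (𝓕 r : MeasurableSpace Ω)
      = ⨆ v ∈ Icc (0 : ℝ) r, MeasurableSpace.comap (fun ω => B (xiD β v) ω) inferInstance)
    (μ : Measure ℝ) (hμ : MemM μ)
    (s t : ℝ) (hs : 0 < s) (hst : s < t) (ht : t ≤ 1) (x : ℝ)
    (X : ℝ → Ω → ℝ)
    (hXcont : ∀ ω, ContinuousOn (fun r => X r ω) (Icc s t))
    (hX : ∀ ω, ∀ r ∈ Icc s t, X r ω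
      = x + (∫ v in s..r, distF μ v * zetaFn β v * deriv (Φ μ v) (X v ω))
          + (B (xiD β r) ω - B (xiD β s) ω)) :
    SCtx P 𝓕 (wFn β μ) (Φ μ) (fun r => deriv (Φ μ r)) (fun r ω => B (xiD β r) ω - B (xiD β s) ω)
      s t (zetaFn β 1) := by
  have hI : ∀ r ∈ Icc s t, r ∈ Icc (0:ℝ) 1 := fun r hr => ⟨hs.le.trans hr.1, hr.2.trans ht⟩
  have h1I : (1:ℝ) ∈ Icc (0:ℝ) 1 := by simp
  have hsI : s ∈ Icc s t := ⟨le_rfl, hst.le⟩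
  have h01 : ∀ r, 0 ≤ wFn β μ r := indicator_nonneg fun r hr =>
    mul_nonneg (distF_nonneg _ _) (zeta_nonneg β hr)
  have hK : ∀ r, wFn β μ r ≤ zetaFn β 1 := by
    refine indicator_le' (fun r hr => ?_) fun _ _ => zeta_nonneg β h1I
    exact (mul_le_of_le_one_left (zeta_nonneg β hr) (distF_le_one hμ r)).trans (zeta_mono hβ hr h1I hr.2)
  have f1c : ContinuousOn (fun p : ℝ × ℝ => deriv (Φ μ p.1) p.2) (Icc s t ×ˢ univ) :=
    (dphi_cont hβ hΦ hμ).mono (prod_mono (fun r hr => hI r hr) le_rfl)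
  have ad : ∀ v r, v ∈ Icc (0:ℝ) r → Measurable[𝓕 r] (B (xiD β v)) := by
    intro v r hv
    rw [h𝓕 r]
    exact (comap_measurable (B (xiD β v))).mono
      (le_iSup₂_of_le (f := fun v (_ : v ∈ Icc (0 : ℝ) r) => MeasurableSpace.comap (fun ω => B (xiD β v) ω) inferInstance) v hv le_rfl) le_rfl
  refine ⟨hst, wFn_meas hβ hμ, h01, hK, fun r hr => phi_c1q hβ hΦ hμ (hI r hr), f1c, ?_, ?_, ?_, ?_, ?_⟩
  · intro r hr
    exact (ad r r ⟨(hI r hr).1, le_rfl⟩).sub (ad s r ⟨hs.le, hr.1⟩)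
  · intro r hr
    have law := hB.2.2.2.1 (xiD β s) (xiD β r) (xiD_nonneg hβ (hI s hsI))
      (xiD_mono hβ (hI s hsI) (hI r hr) hr.1)
    have h1 := nG_int_id (xiD β r - xiD β s)
    rw [nG, ← law] at h1
    exact h1.comp_measurable ((hB.1 _).sub (hB.1 _))
  · intro ω
    have e : ∀ r ∈ Icc s t, B (xiD β r) ω - B (xiD β s) ω =
        X r ω - x - ∫ v in s..r, wFn β μ v * deriv (Φ μ v) (X v ω) := by
      intro r hr
      have := hX ω r hr
      rw [wFn_int β μ (hI s hsI) (hI r hr)] at this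
      linarith
    refine ContinuousOn.congr ?_ e
    refine ((hXcont ω).sub continuousOn_const).sub ?_
    have hc : ContinuousOn (fun r => deriv (Φ μ r) (X r ω)) (Icc s t) :=
      f1c.comp (f := fun r => (r, X r ω)) (continuousOn_id.prodMk (hXcont ω)) fun r hr => ⟨hr, trivial⟩
    have hwi : IntervalIntegrable (wFn β μ) volume s t :=
      (intervalIntegrable_const (c := zetaFn β 1)).mono_fun (wFn_meas hβ hμ).aestronglyMeasurable
        (.of_forall fun r => by
          change |wFn β μ r| ≤ |zetaFn β 1|
          rw [abs_of_nonneg (h01 r)]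
          exact (hK r).trans (le_abs_self _))
    have hii : IntervalIntegrable (fun v => wFn β μ v * deriv (Φ μ v) (X v ω)) volume s t :=
      hwi.mul_continuousOn (by rwa [Set.uIcc_of_le hst.le])
    have := intervalIntegral.continuousOn_primitive_interval (a := s) (b := t)
      (f := fun v => wFn β μ v * deriv (Φ μ v) (X v ω)) (μ := volume) (by
        rw [Set.uIcc_of_le hst.le, integrableOn_Icc_iff_integrableOn_Ioc]
        exact (intervalIntegrable_iff_integrableOn_Ioc_of_le hst.le).1 hii)
    rwa [Set.uIcc_of_le hst.le] at this
  · intro ω; simp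
  · intro a b ha hab hb Z c C hZ hZi hc hC
    have haI : a ∈ Icc (0:ℝ) 1 := hI a ⟨ha, by linarith⟩
    have hbI : b ∈ Icc (0:ℝ) 1 := hI b ⟨by linarith, hb⟩
    have hxa := xiD_nonneg hβ haI
    have hxab := xiD_mono hβ haI hbI hab.le
    have hle : 𝓕 a ≤ ⨆ v ∈ Icc (0 : ℝ) (xiD β a), MeasurableSpace.comap (B v) inferInstance := by
      rw [h𝓕 a]
      refine iSup₂_le fun v hv => ?_
      have hvI : v ∈ Icc (0:ℝ) 1 := ⟨hv.1, hv.2.trans haI.2⟩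
      exact le_iSup₂_of_le (f := fun v (_ : v ∈ Icc (0 : ℝ) (xiD β a)) => MeasurableSpace.comap (B v) inferInstance)
        (xiD β v) ⟨xiD_nonneg hβ hvI, xiD_mono hβ hvI haI hv.2⟩ le_rfl
    have key := step_indep (𝓕.le a) (phi_c1q hβ hΦ hμ hbI) (phi_c1q hβ hΦ hμ haI)
      (τ := xiD β b - xiD β a) (A := ∫ r in a..b, wFn β μ r) (fun z c => by
        rw [← wFn_int1 β μ haI hbI]
        exact phi_ineq hβ hΦ hμ haI.1 hab hbI.2 z c)
      (N := fun ω => B (xiD β b) ω - B (xiD β a) ω) ((hB.1 _).sub (hB.1 _))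
      (hB.2.2.2.1 _ _ hxa hxab) (indep_of_indep_of_le_right (hB.2.2.2.2 _ _ hxa hxab) hle)
      hZ hZi hc hC
    simpa only [sub_sub_sub_cancel_right] using key

theorem main15 {Ω : Type*} [mΩ : MeasurableSpace Ω] (P : Measure Ω) [IsProbabilityMeasure P]
    (β : ℕ → ℝ) (hβ : ValidBeta β)
    (Φ : Measure ℝ → ℝ → ℝ → ℝ) (hΦ : IsParisiFamily β Φ)
    (B : ℝ → Ω → ℝ) (hB : IsStdBM P B)
    (𝓕 : Filtration ℝ mΩ)
    (h𝓕 : ∀ r : ℝ, (𝓕 r : MeasurableSpace Ω)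
      = ⨆ v ∈ Icc (0 : ℝ) r, MeasurableSpace.comap (fun ω => B (xiD β v) ω) inferInstance)
    (μ : Measure ℝ) (hμ : MemM μ)
    (s t : ℝ) (hs : 0 < s) (hst : s < t) (ht : t ≤ 1)
    (hαs : 0 < distF μ s)
    (hsmall : (∫ r in s..t, distF μ r * zetaFn β r) < 1) (x : ℝ)
    (X : ℝ → Ω → ℝ)
    (hXcont : ∀ ω, ContinuousOn (fun r => X r ω) (Icc s t))
    (hX : ∀ ω, ∀ r ∈ Icc s t, X r ω
      = x + (∫ v in s..r, distF μ v * zetaFn β v * deriv (Φ μ v) (X v ω))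
          + (B (xiD β r) ω - B (xiD β s) ω))
    (u : ℝ → Ω → ℝ) (hu : InD 𝓕 s t u)
    (hmax : Ffn P β μ (Φ μ) (fun r => B (xiD β r)) s t u x = Φ μ s x) :
    normD P s t (fun r ω => u r ω - deriv (Φ μ r) (X r ω)) = 0 := by
  have hI : ∀ r ∈ Icc s t, r ∈ Icc (0:ℝ) 1 := fun r hr => ⟨hs.le.trans hr.1, hr.2.trans ht⟩
  have hsI : s ∈ Icc s t := ⟨le_rfl, hst.le⟩
  have htI : t ∈ Icc s t := ⟨hst.le, le_rfl⟩
  have h := mk_ctx P β hβ Φ hΦ B hB 𝓕 h𝓕 μ hμ s t hs hst ht x X hXcont hX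
  have hJ : Jf P (wFn β μ) (Φ μ) (fun r ω => B (xiD β r) ω - B (xiD β s) ω) s x u t = Φ μ s x := by
    rw [← hmax, Jf, Ffn]
    congr 1; funext ω
    rw [wFn_int β μ (hI s hsI) (hI t htI), wFn_int β μ (hI s hsI) (hI t htI)]
    rfl
  have key := h.unique (Ctl.of_prog hu.1 hu.2) hJ (fun r hr => ?_) ?_ hXcont (fun ω r hr => ?_)
  · rw [normD, key, Real.sqrt_zero]
  · rw [wFn_eq β μ (hI r hr)]
    exact mul_pos (hαs.trans_le (distF_mono hμ hr.1)) (zeta_pos hβ (hI r hr) (hs.trans_le hr.1))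
  · rwa [← wFn_int1 β μ (hI s hsI) (hI t htI)]
  · rw [hX ω r hr, wFn_int β μ (hI s hsI) (hI r hr)]


/-- **Uniqueness of the maximizer (Proposition 3).** If `0 < s < t ≤ 1`,
`α(s) > 0` and `∫_s^t α(r)ζ(r) dr < 1`, then any `u ∈ 𝓓[s,t]` attaining
`F^{s,t}(u,x) = Φ_μ(s,x)` agrees in `‖·‖` with `u*(r) = ∂ₓΦ_μ(r, X(r))`, where
`X` solves the associated SDE. -/
theorem stmt15 {Ω : Type*} [mΩ : MeasurableSpace Ω] (P : Measure Ω) [IsProbabilityMeasure P]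
    (β : ℕ → ℝ) (hβ : ValidBeta β)
    (Φ : Measure ℝ → ℝ → ℝ → ℝ) (hΦ : IsParisiFamily β Φ)
    (B : ℝ → Ω → ℝ) (hB : IsStdBM P B)
    (𝓕 : Filtration ℝ mΩ)
    (h𝓕 : ∀ r : ℝ, (𝓕 r : MeasurableSpace Ω)
      = ⨆ v ∈ Icc (0 : ℝ) r, MeasurableSpace.comap (fun ω => B (xiD β v) ω) inferInstance)
    (μ : Measure ℝ) (hμ : MemM μ)
    (s t : ℝ) (hs : 0 < s) (hst : s < t) (ht : t ≤ 1)
    (hαs : 0 < distF μ s)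
    (hsmall : (∫ r in s..t, distF μ r * zetaFn β r) < 1) (x : ℝ)
    (X : ℝ → Ω → ℝ)
    (hXcont : ∀ ω, ContinuousOn (fun r => X r ω) (Icc s t))
    (hXadap : ∀ r ∈ Icc s t, StronglyMeasurable[𝓕 r] (X r))
    (hX : ∀ ω, ∀ r ∈ Icc s t, X r ω
      = x + (∫ v in s..r, distF μ v * zetaFn β v * deriv (Φ μ v) (X v ω))
          + (B (xiD β r) ω - B (xiD β s) ω))
    (u : ℝ → Ω → ℝ) (hu : InD 𝓕 s t u)
    (hmax : Ffn P β μ (Φ μ) (fun r => B (xiD β r)) s t u x = Φ μ s x) :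
    normD P s t (fun r ω => u r ω - deriv (Φ μ r) (X r ω)) = 0 := by
  exact main15 P β hβ Φ hΦ B hB 𝓕 h𝓕 μ hμ s t hs hst ht hαs hsmall x X hXcont hX u hu hmax

end
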